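/- There exist positive constants C and c such that, uniformly for all sufficiently large x and every real primitive Dirichlet character χ of conductor d ≤ exp[C(log x)^{1/2}] for which L(s, χ) has no real zero β with β > 1 − c/log x, one has Σ_{a ≤ √x, a prime} χ(a)·Li(x/a) = (x/log x)·(𝓛_χ + O(1)), where Li denotes the logarithmic integral and the implied constant is absolute. -/

import Mathlib

open Filter

/-- The Dirichlet L-function of `χ` (extended by `0` for modulus `0`). -/
noncomputable def LFun (d : ℕ) (χ : DirichletCharacter ℂ d) (s : ℂ) : ℂ :=
  if h : d ≠ 0 then
    letI : NeZero d := ⟨h⟩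
    DirichletCharacter.LFunction χ s
  else 0

/-- `𝓛_χ = Σ_p χ(p)/p` has value `L`: the partial sums over primes `p < y`
converge to `L` as `y → ∞`. -/
def HasCurlyL {d : ℕ} (χ : DirichletCharacter ℂ d) (L : ℝ) : Prop :=
  Filter.Tendsto
    (fun y : ℕ => ∑ p ∈ (Finset.range y).filter Nat.Prime, (χ p).re / (p : ℝ))
    Filter.atTop (nhds L)

/-- Number of ordered pairs `(p, q)` of primes with `p * q ≤ x` satisfying `P p q`. -/
noncomputable def pairCount (x : ℝ) (P : ℕ → ℕ → Prop) : ℕ :=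
  Nat.card {pq : ℕ × ℕ // pq.1.Prime ∧ pq.2.Prime ∧ ((pq.1 * pq.2 : ℕ) : ℝ) ≤ x ∧ P pq.1 pq.2}

/-- The race ratio `#{pq ≤ x : χ(p) = χ(q) = η} / ((1/4) #{pq ≤ x : gcd(pq, d) = 1})`,
where products of two primes are counted as ordered pairs. -/
noncomputable def raceRatio {d : ℕ} (χ : DirichletCharacter ℂ d) (η : ℂ) (x : ℝ) : ℝ :=
  (pairCount x (fun p q => χ p = η ∧ χ q = η) : ℝ) /
    ((1 / 4 : ℝ) * (pairCount x (fun p q => Nat.gcd (p * q) d = 1) : ℝ))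

/-- A positive integer is a fundamental discriminant if it is `≡ 1 (mod 4)` and squarefree,
or is `4m` with `m ≡ 2, 3 (mod 4)` squarefree. -/
def IsFundamentalDiscriminant (d : ℕ) : Prop :=
  0 < d ∧ ((d % 4 = 1 ∧ Squarefree d) ∨
    (d % 4 = 0 ∧ Squarefree (d / 4) ∧ (d / 4 % 4 = 2 ∨ d / 4 % 4 = 3)))

/-- The Generalized Riemann Hypothesis for Dirichlet L-functions: all zeros in the
critical strip lie on the critical line. -/
def GRH : Prop :=
  ∀ (d : ℕ), d ≠ 0 → ∀ (χ : DirichletCharacter ℂ d) (s : ℂ),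
    LFun d χ s = 0 → 0 < s.re → s.re < 1 → s.re = 1 / 2

/-- `L(s, χ)` has no real zero `β` with `1 - c / log d ≤ β ≤ 1` (a Siegel zero). -/
def HasNoSiegelZero (c : ℝ) (d : ℕ) (χ : DirichletCharacter ℂ d) : Prop :=
  ¬ ∃ β : ℝ, 1 - c / Real.log d ≤ β ∧ β ≤ 1 ∧ LFun d χ (β : ℂ) = 0

/-- The logarithmic integral `Li(t) = ∫_2^t du / log u`. -/
noncomputable def Li (t : ℝ) : ℝ := ∫ u in (2:ℝ)..t, 1 / Real.log u

section PartA

open Filter Topology Metric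

lemma entire_factor_one {f : ℂ → ℂ} (hf : Differentiable ℂ f) {s0 : ℂ} (h0 : f s0 ≠ 0) (ρ : ℂ) :
    ∃ (n : ℕ) (g : ℂ → ℂ), Differentiable ℂ g ∧ g ρ ≠ 0 ∧ ∀ z, f z = (z - ρ) ^ n * g z := by
  have hd : ∀ n : ℕ, Differentiable ℂ ((Function.swap dslope ρ)^[n] f) := by
    intro n
    induction n with
    | zero => simpa using hf
    | succ k ih =>
      rw [Function.iterate_succ_apply']
      have := (Complex.differentiableOn_dslope (s := Set.univ) (c := ρ) (f := (Function.swap dslope ρ)^[k] f) univ_mem).2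
        ih.differentiableOn
      exact differentiableOn_univ.1 this
  obtain ⟨p, hp⟩ := hf.analyticAt ρ
  have hpne : p ≠ 0 := by
    intro hp0
    have h1 : ∀ᶠ z in 𝓝 ρ, f z = 0 := hp.locally_zero_iff.2 hp0
    have h2 : f = fun _ => 0 := by
      refine AnalyticOnNhd.eq_of_eventuallyEq (𝕜 := ℂ) (z₀ := ρ) ?_ ?_ h1
      · exact fun z _ => hf.analyticAt z
      · exact fun z _ => analyticAt_const
    exact h0 (by rw [h2])
  refine ⟨p.order, (Function.swap dslope ρ)^[p.order] f, hd _, hp.iterate_dslope_fslope_ne_zero hpne, ?_⟩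
  intro z
  simpa using hp.eq_pow_order_mul_iterate_dslope z

lemma entire_factor {f : ℂ → ℂ} (hf : Differentiable ℂ f) {s0 : ℂ} (h0 : f s0 ≠ 0) (S : Finset ℂ) :
    ∃ (m : ℂ → ℕ) (g : ℂ → ℂ), Differentiable ℂ g ∧ (∀ ρ ∈ S, g ρ ≠ 0) ∧
      ∀ z, f z = (∏ ρ ∈ S, (z - ρ) ^ m ρ) * g z := by
  classical
  induction S using Finset.induction_on with
  | empty => exact ⟨fun _ => 0, f, hf, by simp, by simp⟩
  | insert a S ha ih =>
    obtain ⟨m, g, hg, hgS, hfg⟩ := ih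
    have hg0 : g s0 ≠ 0 := by
      intro h
      apply h0
      rw [hfg, h, mul_zero]
    obtain ⟨n, g', hg', hga, hgg⟩ := entire_factor_one hg hg0 a
    refine ⟨Function.update m a n, g', hg', ?_, ?_⟩
    · intro ρ hρ
      rcases Finset.mem_insert.1 hρ with rfl | h
      · exact hga
      · intro h'
        exact hgS ρ h (by rw [hgg, h', mul_zero])
    · intro z
      rw [Finset.prod_insert ha, hfg, hgg]
      have : ∏ x ∈ S, (z - x) ^ (Function.update m a n) x = ∏ x ∈ S, (z - x) ^ m x := by
        refine Finset.prod_congr rfl fun x hx => ?_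
        rw [Function.update_of_ne]
        rintro rfl
        exact ha hx
      rw [this]
      simp
      ring

lemma entire_zeros_finite {f : ℂ → ℂ} (hf : Differentiable ℂ f) {s0 : ℂ} (h0 : f s0 ≠ 0) (r : ℝ) :
    {z | z ∈ closedBall s0 r ∧ f z = 0}.Finite := by
  by_contra hinf
  obtain ⟨z, -, hz⟩ := Set.Infinite.exists_accPt_of_subset_isCompact (K := closedBall s0 r) hinf
    (isCompact_closedBall s0 r) (fun z hz => hz.1)
  have hfr : ∃ᶠ w in 𝓝[≠] z, f w = 0 := by
    rw [accPt_iff_frequently_nhdsNE] at hz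
    exact hz.mono fun w hw => hw.2
  have := AnalyticOnNhd.eqOn_zero_of_preconnected_of_frequently_eq_zero (𝕜 := ℂ) (f := f) (U := Set.univ)
    (fun z _ => hf.analyticAt z) isPreconnected_univ (Set.mem_univ z) hfr
  exact h0 (this (Set.mem_univ s0))

/-- local factorisation of an entire function around `s0` -/
lemma landau_factor {f : ℂ → ℂ} (hf : Differentiable ℂ f) {s0 : ℂ} (h0 : f s0 ≠ 0) {M R : ℝ}
    (hM : 0 < M) (hR : 0 < R) (hb : ∀ z ∈ closedBall s0 R, ‖f z‖ ≤ Real.exp M * ‖f s0‖) :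
    ∃ (S : Finset ℂ) (m : ℂ → ℕ) (E : ℂ), (∀ ρ, ρ ∈ S ↔ ρ ∈ closedBall s0 (R / 2) ∧ f ρ = 0) ∧
      (∀ ρ ∈ S, 1 ≤ m ρ) ∧ ‖E‖ ≤ 8 * M / R ∧
      deriv f s0 / f s0 = ∑ ρ ∈ S, (m ρ : ℂ) / (s0 - ρ) + E ∧
      ∀ z ∈ ball s0 (R / 2), ∃ e : ℝ, |e| ≤ 2 * M * ‖z - s0‖ / (R / 2 - ‖z - s0‖) ∧
        ‖f z‖ = ‖f s0‖ * (∏ ρ ∈ S, (‖z - ρ‖ / ‖s0 - ρ‖) ^ m ρ) * Real.exp e := by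
  classical
  set S := (entire_zeros_finite hf h0 (R / 2)).toFinset with hS
  obtain ⟨m, g, hg, hgS, hfg⟩ := entire_factor hf h0 S
  have hmem : ∀ ρ, ρ ∈ S ↔ ρ ∈ closedBall s0 (R / 2) ∧ f ρ = 0 := by
    intro ρ
    simp [hS]
  have hne : ∀ ρ ∈ S, s0 - ρ ≠ 0 := by
    intro ρ hρ h
    rw [sub_eq_zero] at h
    exact h0 (h ▸ ((hmem ρ).1 hρ).2)
  have hg0 : g s0 ≠ 0 := by
    intro h
    apply h0
    rw [hfg, h, mul_zero]
  have hm : ∀ ρ ∈ S, 1 ≤ m ρ := by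
    intro ρ hρ
    by_contra! hlt
    have hmρ : m ρ = 0 := by omega
    have hz := ((hmem ρ).1 hρ).2
    rw [hfg] at hz
    rcases mul_eq_zero.1 hz with h | h
    · rw [Finset.prod_eq_zero_iff] at h
      obtain ⟨a, ha, h⟩ := h
      by_cases haρ : a = ρ
      · subst haρ
        simp [hmρ] at h
      · exact haρ (sub_eq_zero.1 (pow_eq_zero_iff (M₀ := ℂ) (fun h' => by simp [h'] at h) |>.1 h)).symm
    · exact hgS ρ hρ h
  have hgne : ∀ z ∈ closedBall s0 (R / 2), g z ≠ 0 := by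
    intro z hz h
    have : z ∈ S := (hmem z).2 ⟨hz, by rw [hfg, h, mul_zero]⟩
    exact hgS z this h
  -- bound on g
  have hPs0 : (∏ ρ ∈ S, (s0 - ρ) ^ m ρ) ≠ 0 :=
    Finset.prod_ne_zero_iff.2 fun ρ hρ => pow_ne_zero _ (hne ρ hρ)
  have hgb : ∀ z ∈ closedBall s0 R, ‖g z‖ ≤ Real.exp M * ‖g s0‖ := by
    intro z hz
    have hcl : closure (ball s0 R) = closedBall s0 R := closure_ball s0 hR.ne'
    refine Complex.norm_le_of_forall_mem_frontier_norm_le (U := ball s0 R) isBounded_ball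
      hg.diffContOnCl (C := Real.exp M * ‖g s0‖) ?_ (hcl ▸ hz)
    intro w hw
    rw [frontier_ball s0 hR.ne'] at hw
    have hw' : ‖w - s0‖ = R := by simpa [dist_eq_norm] using hw
    have h1 := hb w (sphere_subset_closedBall hw)
    rw [hfg w, hfg s0, norm_mul, norm_mul] at h1
    have h2 : ‖∏ ρ ∈ S, (s0 - ρ) ^ m ρ‖ ≤ ‖∏ ρ ∈ S, (w - ρ) ^ m ρ‖ := by
      rw [norm_prod, norm_prod]
      refine Finset.prod_le_prod (fun _ _ => norm_nonneg _) fun ρ hρ => ?_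
      rw [norm_pow, norm_pow]
      refine pow_le_pow_left₀ (norm_nonneg _) ?_ _
      have h3 : ‖s0 - ρ‖ ≤ R / 2 := by
        have := ((hmem ρ).1 hρ).1
        rw [mem_closedBall, dist_comm, dist_eq_norm] at this
        exact this
      have h4 : ‖w - s0‖ ≤ ‖w - ρ‖ + ‖s0 - ρ‖ := by
        have := norm_sub_le (w - ρ) (s0 - ρ)
        simpa using this
      linarith
    have h5 : 0 < ‖∏ ρ ∈ S, (s0 - ρ) ^ m ρ‖ := norm_pos_iff.2 hPs0
    have h6 : ‖∏ ρ ∈ S, (s0 - ρ) ^ m ρ‖ * ‖g w‖ ≤ ‖∏ ρ ∈ S, (s0 - ρ) ^ m ρ‖ * (Real.exp M * ‖g s0‖) := by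
      calc _ ≤ ‖∏ ρ ∈ S, (w - ρ) ^ m ρ‖ * ‖g w‖ := by gcongr
        _ ≤ _ := h1
        _ = _ := by ring
    exact le_of_mul_le_mul_left h6 h5
  -- logarithm
  obtain ⟨h, hh, hexp⟩ : ∃ h : ℂ → ℂ, DifferentiableOn ℂ h (ball s0 (R / 2)) ∧
      h s0 = 0 ∧ ∀ z ∈ ball s0 (R / 2), g z = g s0 * Complex.exp (h z) := by
    have hd : DifferentiableOn ℂ (fun z => deriv g z / g z) (ball s0 (R / 2)) := by
      intro z hz
      refine DifferentiableAt.differentiableWithinAt ?_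
      exact (hg.analyticAt z).deriv.differentiableAt.div (hg z) (hgne z (ball_subset_closedBall hz))
    obtain ⟨h, hh⟩ := hd.isExactOn_ball
    have hs0 : s0 ∈ ball s0 (R / 2) := mem_ball_self (by positivity)
    refine ⟨fun z => h z - h s0, ?_, by simp, ?_⟩
    · intro z hz
      exact ((hh z hz).differentiableAt.sub_const _).differentiableWithinAt
    · intro z hz
      have hc : ∀ w ∈ ball s0 (R / 2), HasDerivAt (fun w => g w * Complex.exp (-(h w - h s0))) 0 w := by
        intro w hw
        have h1 := (hg w).hasDerivAt.mul ((((hh w hw).sub_const (h s0)).neg).cexp)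
        refine h1.congr_deriv ?_
        have := hgne w (ball_subset_closedBall hw)
        change deriv g w * Complex.exp (-(h w - h s0)) + g w * (Complex.exp (-(h w - h s0)) * -(deriv g w / g w)) = 0
        field_simp
        ring
      have := (convex_ball s0 (R / 2)).is_const_of_fderivWithin_eq_zero (𝕜 := ℂ)
        (f := fun w => g w * Complex.exp (-(h w - h s0))) (x := z) (y := s0)
        (fun w hw => (hc w hw).differentiableAt.differentiableWithinAt)
        (fun w hw => by
          rw [fderivWithin_of_isOpen isOpen_ball hw]
          have := (hc w hw).hasFDerivAt.fderiv
          rw [this]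
          ext; simp) hz hs0
      simp only [sub_self, neg_zero, Complex.exp_zero, mul_one] at this
      rw [← this, mul_assoc, ← Complex.exp_add]
      simp
  obtain ⟨hh0, hexp⟩ := hexp
  have hre : ∀ z ∈ ball s0 (R / 2), (h z).re ≤ M := by
    intro z hz
    have h1 := hgb z (closedBall_subset_closedBall (by linarith) (ball_subset_closedBall hz))
    rw [hexp z hz, norm_mul, Complex.norm_exp, mul_comm] at h1
    have h2 := le_of_mul_le_mul_right h1 (norm_pos_iff.2 hg0)
    exact Real.exp_le_exp.1 h2
  have hbc : ∀ z ∈ ball s0 (R / 2), ‖h z‖ ≤ 2 * M * ‖z - s0‖ / (R / 2 - ‖z - s0‖) := by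
    intro z hz
    have hmaps : Set.MapsTo (fun w : ℂ => s0 + w) (ball 0 (R / 2)) (ball s0 (R / 2)) := by
      intro w hw
      simpa [dist_eq_norm] using hw
    have := Complex.borelCaratheodory_zero (f := fun w => h (s0 + w)) (R := R / 2) (z := z - s0) hM
      (hh.comp (by fun_prop) hmaps) (fun w hw => hre _ (hmaps hw)) (by positivity)
      (by simpa [dist_eq_norm] using hz) (by simpa using hh0)
    simpa using this
  have hs0 : s0 ∈ ball s0 (R / 2) := mem_ball_self (by positivity)
  have hderiv : ‖deriv h s0‖ ≤ 8 * M / R := by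
    have h1 : DiffContOnCl ℂ h (ball s0 (R / 4)) := by
      refine DifferentiableOn.diffContOnCl ?_
      rw [closure_ball s0 (by positivity)]
      exact hh.mono (closedBall_subset_ball (by linarith))
    have h2 := Complex.norm_deriv_le_of_forall_mem_sphere_norm_le (R := R / 4) (C := 2 * M)
      (by positivity) h1 ?_
    · convert h2 using 1
      field_simp
      ring
    · intro z hz
      have hz' : ‖z - s0‖ = R / 4 := by simpa [dist_eq_norm] using hz
      have := hbc z (by rw [mem_ball, dist_eq_norm, hz']; linarith)
      rw [hz'] at this
      convert this using 1
      field_simp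
      ring
  refine ⟨S, m, deriv h s0, hmem, hm, hderiv, ?_, ?_⟩
  · have hgd : HasDerivAt g (g s0 * deriv h s0) s0 := by
      have hhd : HasDerivAt h (deriv h s0) s0 :=
        (hh.differentiableAt (isOpen_ball.mem_nhds hs0)).hasDerivAt
      have h1 := (hhd.cexp).const_mul (g s0)
      rw [hh0, Complex.exp_zero, one_mul] at h1
      refine h1.congr_of_eventuallyEq ?_
      filter_upwards [isOpen_ball.mem_nhds hs0] with z hz using hexp z hz
    have hfe : f = fun z => (∏ ρ ∈ S, (z - ρ) ^ m ρ) * g z := funext hfg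
    have hld : logDeriv f s0 = ∑ ρ ∈ S, (m ρ : ℂ) / (s0 - ρ) + deriv h s0 := by
      rw [hfe, logDeriv_mul s0 hPs0 hg0 (by fun_prop) (hg s0)]
      congr 1
      · rw [logDeriv_prod (f := fun ρ z => (z - ρ) ^ m ρ) (fun ρ hρ => pow_ne_zero _ (hne ρ hρ)) (fun ρ hρ => by fun_prop)]
        refine Finset.sum_congr rfl fun ρ hρ => ?_
        rw [logDeriv_fun_pow (by fun_prop)]
        rw [logDeriv_apply]
        simp [div_eq_mul_inv]
      · rw [logDeriv_apply, hgd.deriv]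
        field_simp
    exact hld
  · intro z hz
    refine ⟨(h z).re, (Complex.abs_re_le_norm _).trans (hbc z hz), ?_⟩
    rw [hfg z, hfg s0, hexp z hz]
    simp only [norm_mul, norm_prod, norm_pow, Complex.norm_exp, div_pow, Finset.prod_div_distrib]
    have : ∏ ρ ∈ S, ‖s0 - ρ‖ ^ m ρ ≠ 0 :=
      Finset.prod_ne_zero_iff.2 fun ρ hρ => pow_ne_zero _ (norm_ne_zero_iff.2 (hne ρ hρ))
    field_simp

end PartA

section PartB

open Filter Topology MeasureTheory

lemma chi_sum_range_eq_zero {d : ℕ} [NeZero d] {χ : DirichletCharacter ℂ d} (hχ : χ ≠ 1) :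
    ∑ k ∈ Finset.range d, χ (k : ZMod d) = 0 := by
  rw [← MulChar.sum_eq_zero_of_ne_one hχ]
  refine Finset.sum_bij' (fun k _ => (k : ZMod d)) (fun a _ => a.val) ?_ ?_ ?_ ?_ ?_
  · simp
  · intro a _
    simpa using ZMod.val_lt a
  · intro k hk
    exact ZMod.val_cast_of_lt (Finset.mem_range.1 hk)
  · intro a _
    simp
  · simp

lemma chi_sum_range_le {d : ℕ} [NeZero d] {χ : DirichletCharacter ℂ d} (hχ : χ ≠ 1) (n : ℕ) :
    ‖∑ k ∈ Finset.range n, χ (k : ZMod d)‖ ≤ d := by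
  have hper : Function.Periodic (fun n => ∑ k ∈ Finset.range n, χ (k : ZMod d)) d := by
    intro n
    simp only
    rw [add_comm, Finset.sum_range_add, chi_sum_range_eq_zero hχ]
    simp
  have := hper.map_mod_nat n
  rw [← this]
  refine (norm_sum_le _ _).trans ?_
  refine (Finset.sum_le_sum (g := fun _ => (1:ℝ)) fun k _ => DirichletCharacter.norm_le_one χ _).trans ?_
  simp
  exact (Nat.mod_lt _ (NeZero.pos d)).le

lemma chi_sum_Icc_le {d : ℕ} [NeZero d] {χ : DirichletCharacter ℂ d} (hχ : χ ≠ 1) (n : ℕ) :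
    ‖∑ k ∈ Finset.Icc 1 n, χ (k : ZMod d)‖ ≤ d := by
  have hd : d ≠ 1 := by
    rintro rfl
    exact hχ (Subsingleton.elim _ _)
  have h0 : χ ((0 : ℕ) : ZMod d) = 0 := by
    simp only [Nat.cast_zero]
    apply χ.map_nonunit
    intro h
    have : Subsingleton (ZMod d) := by
      rw [isUnit_zero_iff] at h
      exact subsingleton_of_zero_eq_one h
    exact hd (by
      have := Fintype.card_le_one_iff_subsingleton.2 this
      rw [ZMod.card] at this
      have := NeZero.pos d
      omega)
  have : ∑ k ∈ Finset.Icc 1 n, χ (k : ZMod d) = ∑ k ∈ Finset.range (n + 1), χ (k : ZMod d) := by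
    rw [Finset.range_eq_Ico, Finset.sum_eq_sum_Ico_succ_bot (by omega), h0, zero_add]
    rfl
  rw [this]
  exact chi_sum_range_le hχ _

noncomputable def chiS {d : ℕ} (χ : DirichletCharacter ℂ d) (t : ℝ) : ℂ :=
  ∑ k ∈ Finset.Icc 1 ⌊t⌋₊, χ (k : ZMod d)

lemma chiS_measurable {d : ℕ} (χ : DirichletCharacter ℂ d) : Measurable (chiS χ) := by
  have : chiS χ = (fun n : ℕ => ∑ k ∈ Finset.Icc 1 n, χ (k : ZMod d)) ∘ fun t : ℝ => ⌊t⌋₊ := rfl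
  rw [this]
  exact (measurable_from_nat).comp Nat.measurable_floor

lemma LFunction_eq_integral {d : ℕ} [NeZero d] {χ : DirichletCharacter ℂ d} (hχ : χ ≠ 1) {s : ℂ}
    (hs : 0 < s.re) :
    χ.LFunction s = s * ∫ t in Set.Ioi (1 : ℝ), chiS χ t * t ^ (-(s + 1)) := by
  set f : ℝ → ℂ := (Set.Ioi (1:ℝ)).indicator (chiS χ) with hf
  have hfb : ∀ t, ‖f t‖ ≤ d := by
    intro t
    rw [hf, Set.indicator_apply]
    split_ifs
    · exact chi_sum_Icc_le hχ _
    · simp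
  have hfm : Measurable f := (chiS_measurable χ).indicator measurableSet_Ioi
  have hmel : ∀ s : ℂ, mellin f (-s) = ∫ t in Set.Ioi (1 : ℝ), chiS χ t * t ^ (-(s + 1)) := by
    intro s
    rw [mellin]
    have : (fun t : ℝ => (t : ℂ) ^ (-s - 1) • f t) =
        (Set.Ioi (1:ℝ)).indicator (fun t : ℝ => chiS χ t * t ^ (-(s + 1))) := by
      ext t
      rw [hf, Set.indicator_apply, Set.indicator_apply]
      split_ifs
      · rw [smul_eq_mul, mul_comm]
        congr 2
        ring
      · simp
    rw [this, setIntegral_indicator measurableSet_Ioi]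
    congr 2
    ext t
    simp
  rw [← hmel]
  have hli : LocallyIntegrableOn f (Set.Ioi 0) := by
    refine LocallyIntegrable.locallyIntegrableOn ?_ _
    have : LocallyIntegrable (fun _ : ℝ => (d : ℝ)) := locallyIntegrable_const _
    exact this.mono hfm.aestronglyMeasurable (Eventually.of_forall fun t => by
      simpa using hfb t)
  have hdiff : DifferentiableOn ℂ (fun s => s * mellin f (-s)) {s | 0 < s.re} := by
    intro s hs
    have h1 : DifferentiableAt ℂ (mellin f) (-s) := by
      refine mellin_differentiableAt_of_isBigO_rpow (a := 0) (b := -s.re - 1) hli ?_ ?_ ?_ ?_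
      · refine Asymptotics.IsBigO.of_bound d (Eventually.of_forall fun t => ?_)
        simpa using hfb t
      · simpa using hs
      · refine Asymptotics.IsBigO.of_bound 1 ?_
        filter_upwards [nhdsWithin_le_nhds (Iio_mem_nhds (show (0:ℝ) < 1 by norm_num))] with t ht
        have : f t = 0 := by
          rw [hf, Set.indicator_of_notMem]
          simp at ht ⊢
          exact ht.le
        rw [this]
        simp
      · simp
    refine DifferentiableAt.differentiableWithinAt ?_
    exact differentiableAt_id.mul (h1.comp s differentiableAt_id.neg)
  have hopen : IsOpen {s : ℂ | 0 < s.re} := isOpen_lt continuous_const Complex.continuous_re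
  have hpre : IsPreconnected {s : ℂ | 0 < s.re} := (convex_halfSpace_re_gt 0).isPreconnected
  have heq : Set.EqOn (χ.LFunction) (fun s => s * mellin f (-s)) {s | 0 < s.re} := by
    refine AnalyticOnNhd.eqOn_of_preconnected_of_eventuallyEq (𝕜 := ℂ) (z₀ := 2) ?_ ?_ hpre (by simp) ?_
    · exact fun z _ => (DirichletCharacter.differentiable_LFunction hχ).analyticAt z
    · exact hdiff.analyticOnNhd hopen
    · have : {s : ℂ | 1 < s.re} ∈ 𝓝 (2 : ℂ) :=
        (isOpen_lt continuous_const Complex.continuous_re).mem_nhds (by simp)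
      filter_upwards [this] with s hs
      have hs : 1 < s.re := hs
      rw [DirichletCharacter.LFunction_eq_LSeries χ hs, hmel]
      refine LSeries_eq_mul_integral (r := 0) _ le_rfl (by linarith) 
        (DirichletCharacter.LSeriesSummable_of_one_lt_re χ hs) ?_
      refine Asymptotics.IsBigO.of_bound d (Eventually.of_forall fun n => ?_)
      simpa using chi_sum_Icc_le hχ n
  exact heq hs

lemma chi_integral_tail_le {d : ℕ} [NeZero d] {χ : DirichletCharacter ℂ d} (hχ : χ ≠ 1) {s : ℂ}
    (hs : 0 < s.re) {T : ℝ} (hT : 0 < T) :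
    IntegrableOn (fun t : ℝ => chiS χ t * t ^ (-(s + 1))) (Set.Ioi T) ∧
    ‖∫ t in Set.Ioi T, chiS χ t * t ^ (-(s + 1))‖ ≤ d * T ^ (-s.re) / s.re := by
  have hInt : IntegrableOn (fun t : ℝ => (d : ℝ) * t ^ (-s.re - 1)) (Set.Ioi T) :=
    (integrableOn_Ioi_rpow_of_lt (by linarith) hT).const_mul _
  have hb : ∀ t ∈ Set.Ioi T, ‖chiS χ t * t ^ (-(s + 1))‖ ≤ (d : ℝ) * t ^ (-s.re - 1) := by
    intro t ht
    have ht0 : 0 < t := hT.trans ht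
    rw [norm_mul, Complex.norm_cpow_eq_rpow_re_of_pos ht0]
    have : (-(s + 1)).re = -s.re - 1 := by simp; ring
    rw [this]
    gcongr
    exact chi_sum_Icc_le hχ _
  constructor
  · refine hInt.mono' ?_ ((ae_restrict_iff' measurableSet_Ioi).2 (Eventually.of_forall hb))
    refine ((chiS_measurable χ).aestronglyMeasurable).mul ?_
    exact (Measurable.pow_const Complex.measurable_ofReal _).aestronglyMeasurable
  · refine (norm_integral_le_of_norm_le hInt ((ae_restrict_iff' measurableSet_Ioi).2 (Eventually.of_forall hb))).trans ?_
    rw [integral_const_mul, integral_Ioi_rpow_of_lt (by linarith) hT]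
    apply le_of_eq
    have : -s.re - 1 + 1 = -s.re := by ring
    rw [this]
    field_simp

lemma LFunction_norm_le {d : ℕ} [NeZero d] {χ : DirichletCharacter ℂ d} (hχ : χ ≠ 1) {s : ℂ}
    (hs : 0 < s.re) : ‖χ.LFunction s‖ ≤ ‖s‖ * (d / s.re) := by
  rw [LFunction_eq_integral hχ hs, norm_mul]
  gcongr
  have := (chi_integral_tail_le hχ hs one_pos).2
  simpa using this

lemma LFunction_conj {d : ℕ} [NeZero d] {χ : DirichletCharacter ℂ d} (hχ : χ ≠ 1) 
    (hq : MulChar.IsQuadratic χ) {s : ℂ} (hs : 0 < s.re) :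
    χ.LFunction (starRingEnd ℂ s) = starRingEnd ℂ (χ.LFunction s) := by
  have hs' : 0 < (starRingEnd ℂ s).re := by simpa using hs
  rw [LFunction_eq_integral hχ hs', LFunction_eq_integral hχ hs, map_mul, ← integral_conj]
  congr 1
  refine setIntegral_congr_fun measurableSet_Ioi fun t ht => ?_
  have ht0 : (0:ℝ) < t := zero_lt_one.trans ht
  simp only [map_mul]
  have h1 : starRingEnd ℂ (chiS χ t) = chiS χ t := by
    rw [chiS, map_sum]
    refine Finset.sum_congr rfl fun k _ => ?_
    rcases hq (k : ZMod d) with h | h | h <;> simp [h]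
  have h2 : starRingEnd ℂ ((t : ℂ) ^ (-(s + 1))) = (t : ℂ) ^ (starRingEnd ℂ (-(s + 1))) := by
    rw [Complex.cpow_conj _ _ (by
      rw [Complex.arg_ofReal_of_nonneg ht0.le]
      exact Real.pi_pos.ne), Complex.conj_ofReal]
  rw [h1, h2]
  simp

end PartB

section PartC

open Filter Topology ArithmeticFunction

lemma vm_term (δ : ℝ) (n : ℕ) :
    LSeries.term (fun n => (vonMangoldt n : ℂ)) ((1 + δ : ℝ) : ℂ) n
      = ((vonMangoldt n * (n : ℝ) ^ (-(1 + δ)) : ℝ) : ℂ) := by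
  rcases eq_or_ne n 0 with rfl | hn
  · simp
  · rw [LSeries.term_of_ne_zero hn, Complex.ofReal_mul, Complex.ofReal_cpow (by positivity),
      div_eq_mul_inv, ← Complex.cpow_neg]
    simp

lemma vm_summable {δ : ℝ} (hδ : 0 < δ) :
    Summable (fun n : ℕ => vonMangoldt n * (n : ℝ) ^ (-(1 + δ))) := by
  have h := LSeriesSummable_vonMangoldt (s := ((1 + δ : ℝ) : ℂ)) (by simpa using hδ)
  rw [LSeriesSummable, funext (vm_term δ)] at h
  exact Complex.summable_ofReal.1 h

lemma vm_tsum {δ : ℝ} (hδ : 0 < δ) :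
    LSeries (fun n => (vonMangoldt n : ℂ)) ((1 + δ : ℝ) : ℂ) =
      ((∑' n : ℕ, vonMangoldt n * (n : ℝ) ^ (-(1 + δ)) : ℝ) : ℂ) := by
  rw [LSeries, funext (vm_term δ), Complex.ofReal_tsum]

lemma vm_bound : ∀ᶠ δ : ℝ in 𝓝[>] 0,
    ∑' n : ℕ, vonMangoldt n * (n : ℝ) ^ (-(1 + δ)) ≤ 11 / 10 / δ := by
  set Z := DirichletCharacter.LFunctionTrivChar₁ 1 with hZ
  have hc : ContinuousAt (fun s ↦ -deriv Z s / Z s) 1 := by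
    have hd := DirichletCharacter.differentiable_LFunctionTrivChar₁ 1
    have h0 := DirichletCharacter.LFunctionTrivChar₁_apply_one_ne_zero 1
    refine ContinuousAt.div ?_ hd.continuous.continuousAt h0
    exact (hd.analyticAt 1).deriv.continuousAt.neg
  obtain ⟨B, hB⟩ : ∃ B : ℝ, ∀ᶠ s in 𝓝 (1:ℂ), ‖-deriv Z s / Z s‖ ≤ B :=
    ⟨_, (hc.norm.eventually_le_const (lt_add_one _))⟩
  have ht : Tendsto (fun δ : ℝ => ((1 + δ : ℝ) : ℂ)) (𝓝[>] 0) (𝓝 1) := by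
    have : Continuous (fun δ : ℝ => ((1 + δ : ℝ) : ℂ)) := by fun_prop
    have := this.tendsto 0
    simp only [add_zero, Complex.ofReal_one] at this
    exact this.mono_left nhdsWithin_le_nhds
  have hsm : ∀ᶠ δ : ℝ in 𝓝[>] 0, δ < 1 / (10 * (|B| + 1)) :=
    nhdsWithin_le_nhds (Iio_mem_nhds (by positivity))
  filter_upwards [ht.eventually hB, hsm, self_mem_nhdsWithin] with δ h1 h2 h3
  have h3 : 0 < δ := h3
  set s : ℂ := ((1 + δ : ℝ) : ℂ) with hs
  have hs1 : s ≠ 1 := by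
    rw [hs]
    norm_cast
    linarith
  have hsre : 1 < s.re := by simp [hs, h3]
  have hζ : riemannZeta s ≠ 0 := riemannZeta_ne_zero_of_one_lt_re hsre
  have hT : DirichletCharacter.LFunctionTrivChar 1 = riemannZeta := DirichletCharacter.LFunction_modOne_eq
  have e1 : Z s = (s - 1) * riemannZeta s := by
    rw [hZ, DirichletCharacter.LFunctionTrivChar₁, Function.update_of_ne hs1, hT]
  have e2 : deriv Z s = (s - 1) * deriv riemannZeta s + riemannZeta s := by
    rw [hZ, DirichletCharacter.deriv_LFunctionTrivChar₁_apply_of_ne_one 1 hs1, hT]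
  have hs1' : s - 1 ≠ 0 := sub_ne_zero.2 hs1
  have e3 : -deriv riemannZeta s / riemannZeta s = -deriv Z s / Z s + 1 / (s - 1) := by
    rw [e1, e2]
    field_simp
    ring
  have e4 := vm_tsum h3
  rw [LSeries_vonMangoldt_eq_deriv_riemannZeta_div hsre, e3] at e4
  have e5 : s - 1 = (δ : ℂ) := by rw [hs]; push_cast; ring
  have e6 : ∑' n : ℕ, vonMangoldt n * (n : ℝ) ^ (-(1 + δ)) ≤ B + 1 / δ := by
    refine (le_abs_self _).trans ?_
    rw [← Real.norm_eq_abs, ← Complex.norm_real, ← e4]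
    refine (norm_add_le _ _).trans (add_le_add h1 ?_)
    rw [e5, norm_div, Complex.norm_real, Real.norm_of_nonneg h3.le]
    simp
  refine e6.trans ?_
  have h7 : B ≤ 1 / 10 / δ := by
    rw [le_div_iff₀ h3]
    rw [lt_div_iff₀ (by positivity)] at h2
    have := le_abs_self B
    nlinarith [abs_nonneg B]
  have : 11 / 10 / δ = 1 / 10 / δ + 1 / δ := by ring
  linarith

lemma zeta_bound : ∀ᶠ δ : ℝ in 𝓝[>] 0, ‖riemannZeta ((1 + δ : ℝ) : ℂ)‖ ≤ 2 / δ := by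
  have ht : Tendsto (fun δ : ℝ => ((1 + δ : ℝ) : ℂ)) (𝓝[>] 0) (𝓝[≠] 1) := by
    refine tendsto_nhdsWithin_iff.2 ⟨?_, ?_⟩
    · have : Continuous (fun δ : ℝ => ((1 + δ : ℝ) : ℂ)) := by fun_prop
      have := this.tendsto 0
      simp only [add_zero, Complex.ofReal_one] at this
      exact this.mono_left nhdsWithin_le_nhds
    · filter_upwards [self_mem_nhdsWithin] with δ h3
      have h3 : 0 < δ := h3
      simp
      exact h3.ne'
  have := (riemannZeta_residue_one.comp ht).norm.eventually_le_const (u := 2) (by simp)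
  filter_upwards [this, self_mem_nhdsWithin] with δ h1 h3
  have h3 : 0 < δ := h3
  rw [le_div_iff₀ h3, mul_comm]
  simp only [Function.comp, norm_mul] at h1
  have : ‖((1 + δ : ℝ) : ℂ) - 1‖ = δ := by
    push_cast
    simp [abs_of_pos h3]
  rwa [this] at h1

lemma L_lower {d : ℕ} [NeZero d] (χ : DirichletCharacter ℂ d) {δ : ℝ} (hδ : 0 < δ)
    (hz : ‖riemannZeta ((1 + δ : ℝ) : ℂ)‖ ≤ 2 / δ) :
    δ / 2 ≤ ‖χ.LFunction ((1 + δ : ℝ) : ℂ)‖ := by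
  set s : ℂ := ((1 + δ : ℝ) : ℂ) with hs
  have hsre : 1 < s.re := by simp [hs, hδ]
  have h1 := DirichletCharacter.LSeries.mul_mu_eq_one χ hsre
  rw [← DirichletCharacter.LFunction_eq_LSeries χ hsre] at h1
  set W := LSeries ((fun n : ℕ => χ (n : ZMod d)) * fun n : ℕ => ((ArithmeticFunction.moebius n : ℤ) : ℂ)) s with hW
  have h2 : ‖W‖ ≤ 2 / δ := by
    refine le_trans ?_ hz
    have hsum := LSeriesSummable_one_iff.2 hsre
    have hz1 := (LSeriesHasSum_one hsre)
    have h3 : ∀ n, LSeries.term 1 s n = ((if n = 0 then 0 else (n:ℝ) ^ (-(1 + δ)) : ℝ) : ℂ) := by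
      intro n
      rcases eq_or_ne n 0 with rfl | hn
      · simp
      · rw [LSeries.term_of_ne_zero hn, if_neg hn, Complex.ofReal_cpow (by positivity),
          div_eq_mul_inv, ← Complex.cpow_neg]
        simp [hs]
    have h4 : Summable (fun n : ℕ => (if n = 0 then 0 else (n:ℝ) ^ (-(1 + δ)) : ℝ)) := by
      rw [LSeriesSummable, funext h3] at hsum
      exact Complex.summable_ofReal.1 hsum
    have h5 : riemannZeta s = ((∑' n : ℕ, (if n = 0 then 0 else (n:ℝ) ^ (-(1 + δ)) : ℝ) : ℝ) : ℂ) := by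
      rw [← LSeries_one_eq_riemannZeta hsre, LSeries, funext h3, Complex.ofReal_tsum]
    rw [h5, Complex.norm_real]
    refine le_trans ?_ (le_abs_self _)
    rw [hW, LSeries]
    refine tsum_of_norm_bounded h4.hasSum fun n => ?_
    rcases eq_or_ne n 0 with rfl | hn
    · simp
    · rw [LSeries.term_of_ne_zero hn, if_neg hn, norm_div, Pi.mul_apply, norm_mul,
        Complex.norm_natCast_cpow_of_pos (Nat.pos_of_ne_zero hn), Real.rpow_neg (by positivity),
        div_eq_mul_inv]
      have : s.re = 1 + δ := by simp [hs]
      rw [this]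
      refine mul_le_of_le_one_left (by positivity) ?_
      refine mul_le_one₀ (DirichletCharacter.norm_le_one χ _) (norm_nonneg _) ?_
      rw [Complex.norm_intCast]
      exact_mod_cast ArithmeticFunction.abs_moebius_le_one
  have h6 : ‖χ.LFunction s‖ * ‖W‖ = 1 := by
    rw [← norm_mul, h1, norm_one]
  have h7 : 1 ≤ ‖χ.LFunction s‖ * (2 / δ) := by
    rw [← h6]; gcongr
  have h8 : ‖χ.LFunction s‖ * (2 / δ) = ‖χ.LFunction s‖ * 2 / δ := by ring
  rw [h8, le_div_iff₀ hδ] at h7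
  linarith

lemma logDeriv_L_bound {d : ℕ} [NeZero d] (χ : DirichletCharacter ℂ d) {δ : ℝ} (hδ : 0 < δ) :
    ‖deriv χ.LFunction ((1 + δ : ℝ) : ℂ) / χ.LFunction ((1 + δ : ℝ) : ℂ)‖ ≤
      ∑' n : ℕ, vonMangoldt n * (n : ℝ) ^ (-(1 + δ)) := by
  set s : ℂ := ((1 + δ : ℝ) : ℂ) with hs
  have hsre : 1 < s.re := by simp [hs, hδ]
  have h1 := DirichletCharacter.LSeries_twist_vonMangoldt_eq χ hsre
  rw [← DirichletCharacter.LFunction_eq_LSeries χ hsre, ← DirichletCharacter.deriv_LFunction_eq_deriv_LSeries χ hsre,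
    neg_div] at h1
  rw [← norm_neg, ← h1, LSeries]
  refine tsum_of_norm_bounded (vm_summable hδ).hasSum fun n => ?_
  rcases eq_or_ne n 0 with rfl | hn
  · simp
  · rw [LSeries.term_of_ne_zero hn, norm_div, Pi.mul_apply, norm_mul,
        Complex.norm_natCast_cpow_of_pos (Nat.pos_of_ne_zero hn), Real.rpow_neg (by positivity),
        div_eq_mul_inv]
    have : s.re = 1 + δ := by simp [hs]
    rw [this]
    gcongr
    rw [Complex.norm_real, Real.norm_of_nonneg vonMangoldt_nonneg]
    exact mul_le_of_le_one_left vonMangoldt_nonneg (DirichletCharacter.norm_le_one χ _)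

end PartC

section PartD

open Filter Topology ArithmeticFunction Metric

lemma zero_log_bound {δ : ℝ} (hδ : 0 < δ) {ρ : ℂ} (hr : ρ.re < 1) (ha : δ / 5 ≤ ‖1 - ρ‖) :
    -(36 * δ) * ((1 + δ - ρ.re) / ‖((1 + δ : ℝ) : ℂ) - ρ‖ ^ 2) ≤
        Real.log (‖1 - ρ‖ / ‖((1 + δ : ℝ) : ℂ) - ρ‖) ∧
      Real.log (‖1 - ρ‖ / ‖((1 + δ : ℝ) : ℂ) - ρ‖) ≤ 0 := by
  set s0 : ℂ := ((1 + δ : ℝ) : ℂ) with hs0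
  have hs0re : s0.re = 1 + δ := by simp [hs0]
  have hs0im : s0.im = 0 := by rw [hs0]; exact Complex.ofReal_im _
  have hp1 : 0 < ‖1 - ρ‖ := lt_of_lt_of_le (by positivity) ha
  have hp2 : 0 < ‖s0 - ρ‖ := by
    refine lt_of_lt_of_le hδ (le_trans ?_ (Complex.re_le_norm _))
    rw [Complex.sub_re, hs0re]
    linarith
  have hsq1 : ‖1 - ρ‖ ^ 2 = (1 - ρ.re) ^ 2 + ρ.im ^ 2 := by
    rw [Complex.sq_norm, Complex.normSq_apply]; simp; ring
  have hsq2 : ‖s0 - ρ‖ ^ 2 = (1 + δ - ρ.re) ^ 2 + ρ.im ^ 2 := by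
    rw [Complex.sq_norm, Complex.normSq_apply, Complex.sub_re, Complex.sub_im, hs0re, hs0im]; ring
  have hle : ‖1 - ρ‖ ≤ ‖s0 - ρ‖ := by
    rw [← sq_le_sq₀ hp1.le hp2.le, hsq1, hsq2]
    nlinarith
  constructor
  · have h6 : ‖s0 - ρ‖ ≤ 6 * ‖1 - ρ‖ := by
      have h1 : s0 - ρ = (δ : ℂ) + (1 - ρ) := by rw [hs0]; push_cast; ring
      have := ha
      rw [h1]
      refine (norm_add_le _ _).trans ?_
      rw [Complex.norm_real, Real.norm_of_nonneg hδ.le]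
      linarith
    have h2 : 2 * Real.log (‖1 - ρ‖ / ‖s0 - ρ‖) = Real.log (‖1 - ρ‖ ^ 2 / ‖s0 - ρ‖ ^ 2) := by
      rw [← div_pow, Real.log_pow]; norm_num
    have h3 := Real.one_sub_inv_le_log_of_pos (x := ‖1 - ρ‖ ^ 2 / ‖s0 - ρ‖ ^ 2) (by positivity)
    rw [inv_div] at h3
    have h4 : -(72 * δ) * ((1 + δ - ρ.re) / ‖s0 - ρ‖ ^ 2) ≤ 1 - ‖s0 - ρ‖ ^ 2 / ‖1 - ρ‖ ^ 2 := by
      have h5 : ‖s0 - ρ‖ ^ 2 ≤ 36 * ‖1 - ρ‖ ^ 2 := by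
        calc ‖s0 - ρ‖ ^ 2 ≤ (6 * ‖1 - ρ‖) ^ 2 := by gcongr
          _ = _ := by ring
      have h7 : ‖s0 - ρ‖ ^ 2 - ‖1 - ρ‖ ^ 2 ≤ 2 * δ * (1 + δ - ρ.re) := by
        rw [hsq1, hsq2]; nlinarith
      have h8 : ‖s0 - ρ‖ ^ 2 / ‖1 - ρ‖ ^ 2 - 1 ≤ 72 * δ * ((1 + δ - ρ.re) / ‖s0 - ρ‖ ^ 2) := by
        rw [div_sub_one (by positivity), mul_div_assoc', div_le_div_iff₀ (by positivity) (by positivity)]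
        have hA : 0 ≤ 2 * δ * (1 + δ - ρ.re) := by
          have : 0 ≤ 1 + δ - ρ.re := by linarith
          positivity
        calc (‖s0 - ρ‖ ^ 2 - ‖1 - ρ‖ ^ 2) * ‖s0 - ρ‖ ^ 2 ≤ (2 * δ * (1 + δ - ρ.re)) * ‖s0 - ρ‖ ^ 2 := by gcongr
          _ ≤ (2 * δ * (1 + δ - ρ.re)) * (36 * ‖1 - ρ‖ ^ 2) := by gcongr
          _ = _ := by ring
      linarith
    linarith
  · exact Real.log_nonpos (by positivity) (by rw [div_le_one hp2]; exact hle)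

set_option maxHeartbeats 1000000 in
lemma log_L_compare {d : ℕ} [NeZero d] {χ : DirichletCharacter ℂ d} (hχ : χ ≠ 1)
    (hq : MulChar.IsQuadratic χ) {δ : ℝ} (hδ : 0 < δ) (hδ8 : δ ≤ 1 / 8)
    (hvm : ∑' n : ℕ, vonMangoldt n * (n : ℝ) ^ (-(1 + δ)) ≤ 11 / 10 / δ)
    (hz : ‖riemannZeta ((1 + δ : ℝ) : ℂ)‖ ≤ 2 / δ)
    (hM : 16 * Real.log (8 * d / δ) ≤ 1 / 10 / δ)
    (hreal : ¬ ∃ β : ℝ, 1 - (1 / 5) * δ < β ∧ χ.LFunction (β : ℂ) = 0) :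
    |Real.log ‖χ.LFunction 1‖ - Real.log ‖χ.LFunction ((1 + δ : ℝ) : ℂ)‖| ≤ 44 := by
  classical
  set s0 : ℂ := ((1 + δ : ℝ) : ℂ) with hs0
  set M := Real.log (8 * d / δ) with hMdef
  have hd1 : (1 : ℝ) ≤ d := by exact_mod_cast NeZero.pos d
  have hexpM : Real.exp M = 8 * d / δ := Real.exp_log (by positivity)
  have hMpos : 0 < M := by
    apply Real.log_pos
    rw [lt_div_iff₀ hδ]
    linarith
  have hlow := L_lower χ hδ hz
  rw [← hs0] at hlow
  have hL0 : χ.LFunction s0 ≠ 0 := by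
    intro h
    rw [h, norm_zero] at hlow
    linarith
  have hs0re : s0.re = 1 + δ := by simp [hs0]
  have hs0im : s0.im = 0 := by rw [hs0]; exact Complex.ofReal_im _
  obtain ⟨S, m, E, hS, hm, hE, hlog, hprod⟩ := landau_factor
    (DirichletCharacter.differentiable_LFunction hχ) hL0 hMpos (R := 1 / 2) (by norm_num) (by
      intro z hz
      rw [mem_closedBall, dist_eq_norm] at hz
      have h1 : |(z - s0).re| ≤ 1 / 2 := (Complex.abs_re_le_norm _).trans hz
      rw [Complex.sub_re, hs0re, abs_le] at h1
      have h2 : 1 / 2 ≤ z.re := by linarith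
      have h3 : ‖z‖ ≤ 2 := by
        have h4 : ‖z‖ ≤ ‖z - s0‖ + ‖s0‖ := by simpa using norm_add_le (z - s0) s0
        have h5 : ‖s0‖ = 1 + δ := by
          rw [hs0, Complex.norm_real, Real.norm_of_nonneg (by linarith)]
        linarith
      refine (LFunction_norm_le hχ (by linarith)).trans ?_
      calc ‖z‖ * (d / z.re) ≤ 2 * (d / (1 / 2)) := by gcongr
        _ = Real.exp M * (δ / 2) := by rw [hexpM]; field_simp; norm_num
        _ ≤ _ := by gcongr)
  have hre1 : ∀ ρ ∈ S, ρ.re < 1 := by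
    intro ρ hρ
    by_contra! h
    exact DirichletCharacter.LFunction_ne_zero_of_one_le_re χ (Or.inl hχ) h ((hS ρ).1 hρ).2
  set q : ℂ → ℝ := fun ρ => ((s0 - ρ)⁻¹).re with hqdef
  have hqeq : ∀ ρ, q ρ = (1 + δ - ρ.re) / ‖s0 - ρ‖ ^ 2 := by
    intro ρ
    simp only [hqdef]
    rw [Complex.inv_re, Complex.sq_norm, Complex.sub_re, hs0re]
  have hnpos : ∀ ρ ∈ S, δ ≤ ‖s0 - ρ‖ := by
    intro ρ hρ
    have := hre1 ρ hρ
    refine le_trans ?_ (Complex.re_le_norm _)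
    rw [Complex.sub_re, hs0re]
    linarith
  have hqpos : ∀ ρ ∈ S, 0 ≤ q ρ := by
    intro ρ hρ
    rw [hqeq]
    have := hre1 ρ hρ
    exact div_nonneg (by linarith) (by positivity)
  have hsum : ∑ ρ ∈ S, (m ρ : ℝ) * q ρ ≤ 12 / 10 / δ := by
    have h1 := congrArg Complex.re hlog
    rw [Complex.add_re, Complex.re_sum] at h1
    have h2 : ∑ ρ ∈ S, ((m ρ : ℂ) / (s0 - ρ)).re = ∑ ρ ∈ S, (m ρ : ℝ) * q ρ := by
      refine Finset.sum_congr rfl fun ρ _ => ?_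
      rw [div_eq_mul_inv, ← Complex.ofReal_natCast, Complex.re_ofReal_mul]
    rw [h2] at h1
    have h3 := (Complex.re_le_norm _).trans (logDeriv_L_bound χ hδ)
    rw [← hs0] at h3
    have h4 : -E.re ≤ 16 * M := by
      have := (neg_le_abs _).trans ((Complex.abs_re_le_norm E).trans hE)
      linarith
    have : 12 / 10 / δ = 11 / 10 / δ + 1 / 10 / δ := by ring
    linarith
  -- zeros stay away from 1
  have haway : ∀ ρ ∈ S, δ / 5 ≤ ‖1 - ρ‖ := by
    intro ρ hρ
    by_contra! hlt
    have hn : ‖s0 - ρ‖ ≤ 6 / 5 * δ := by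
      have h1 : s0 - ρ = (δ : ℂ) + (1 - ρ) := by rw [hs0]; push_cast; ring
      rw [h1]
      refine (norm_add_le _ _).trans ?_
      rw [Complex.norm_real, Real.norm_of_nonneg hδ.le]
      linarith
    by_cases him : ρ.im = 0
    · apply hreal
      refine ⟨ρ.re, ?_, ?_⟩
      · have h1 := (Complex.re_le_norm (1 - ρ))
        rw [Complex.sub_re, Complex.one_re] at h1
        linarith
      · have : ((ρ.re : ℝ) : ℂ) = ρ := by
          apply Complex.ext <;> simp [him]
        rw [this]
        exact ((hS ρ).1 hρ).2
    · have hρb := ((hS ρ).1 hρ).1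
      rw [mem_closedBall, dist_eq_norm] at hρb
      have hρre : 0 < ρ.re := by
        have h1 : |(ρ - s0).re| ≤ 1 / 2 / 2 := (Complex.abs_re_le_norm _).trans hρb
        rw [Complex.sub_re, hs0re, abs_le] at h1
        linarith
      have hconj0 : starRingEnd ℂ s0 = s0 := by rw [hs0, Complex.conj_ofReal]
      have hnc : ‖s0 - starRingEnd ℂ ρ‖ = ‖s0 - ρ‖ := by
        rw [← Complex.norm_conj (s0 - ρ), map_sub, hconj0]
      have hc : starRingEnd ℂ ρ ∈ S := by
        rw [hS]
        refine ⟨?_, ?_⟩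
        · rw [mem_closedBall, dist_eq_norm, norm_sub_rev, hnc, norm_sub_rev]
          exact hρb
        · rw [LFunction_conj hχ hq hρre, ((hS ρ).1 hρ).2, _root_.map_zero]
      have hne : ρ ≠ starRingEnd ℂ ρ := by
        intro h
        have := congrArg Complex.im h
        rw [Complex.conj_im] at this
        exact him (by linarith)
      have hsub : ({ρ, starRingEnd ℂ ρ} : Finset ℂ) ⊆ S := by
        intro z hz
        rcases Finset.mem_insert.1 hz with rfl | h
        · exact hρ
        · rw [Finset.mem_singleton.1 h]; exact hc
      have h1 : ∑ z ∈ ({ρ, starRingEnd ℂ ρ} : Finset ℂ), (m z : ℝ) * q z ≤ ∑ z ∈ S, (m z : ℝ) * q z :=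
        Finset.sum_le_sum_of_subset_of_nonneg hsub fun z hz _ => mul_nonneg (by positivity) (hqpos z hz)
      rw [Finset.sum_pair hne] at h1
      have hq1 : 25 / 36 / δ ≤ q ρ := by
        rw [hqeq, div_div, div_le_div_iff₀ (by positivity) (pow_pos (lt_of_lt_of_le hδ (hnpos ρ hρ)) 2)]
        have h2 := hre1 ρ hρ
        have h3 : ‖s0 - ρ‖ ^ 2 ≤ (6 / 5 * δ) ^ 2 := by gcongr
        nlinarith
      have hq2 : q (starRingEnd ℂ ρ) = q ρ := by
        rw [hqeq, hqeq, hnc, Complex.conj_re]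
      rw [hq2] at h1
      have hm1 : (1 : ℝ) ≤ m ρ := by exact_mod_cast hm ρ hρ
      have hm2 : (1 : ℝ) ≤ m (starRingEnd ℂ ρ) := by exact_mod_cast hm _ hc
      have h4 : 2 * (25 / 36 / δ) ≤ 12 / 10 / δ := by
        nlinarith [hqpos ρ hρ]
      have h5 : 12 / 10 / δ - 2 * (25 / 36 / δ) = -(17 / 90) / δ := by ring
      have h6 : -(17 / 90) / δ < 0 := div_neg_of_neg_of_pos (by norm_num) hδ
      linarith
  obtain ⟨e, he, hfin⟩ := hprod 1 (by
    rw [mem_ball, dist_eq_norm]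
    have : (1 : ℂ) - s0 = ((-δ : ℝ) : ℂ) := by rw [hs0]; push_cast; ring
    rw [this, Complex.norm_real, norm_neg, Real.norm_of_nonneg hδ.le]
    linarith)
  have hn1 : ‖(1 : ℂ) - s0‖ = δ := by
    have : (1 : ℂ) - s0 = ((-δ : ℝ) : ℂ) := by rw [hs0]; push_cast; ring
    rw [this, Complex.norm_real, norm_neg, Real.norm_of_nonneg hδ.le]
  rw [hn1] at he
  have he' : |e| ≤ 1 / 10 := by
    refine he.trans ?_
    rw [div_le_iff₀ (by linarith)]
    have : 16 * M * δ ≤ 1 / 10 := by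
      rwa [le_div_iff₀ hδ] at hM
    nlinarith
  have hpos1 : ∀ ρ ∈ S, 0 < ‖1 - ρ‖ := fun ρ hρ => lt_of_lt_of_le (by positivity) (haway ρ hρ)
  have hpos2 : ∀ ρ ∈ S, 0 < ‖s0 - ρ‖ := fun ρ hρ => lt_of_lt_of_le hδ (hnpos ρ hρ)
  have hpp : 0 < ∏ ρ ∈ S, (‖1 - ρ‖ / ‖s0 - ρ‖) ^ m ρ :=
    Finset.prod_pos fun ρ hρ => pow_pos (div_pos (hpos1 ρ hρ) (hpos2 ρ hρ)) _
  rw [hfin, Real.log_mul (mul_ne_zero (norm_ne_zero_iff.2 hL0) hpp.ne') (Real.exp_ne_zero _),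
    Real.log_mul (norm_ne_zero_iff.2 hL0) hpp.ne', Real.log_exp, Real.log_prod
      (fun ρ hρ => (pow_pos (div_pos (hpos1 ρ hρ) (hpos2 ρ hρ)) _).ne')]
  simp only [Real.log_pow]
  have hone : ∀ ρ ∈ S, -(36 * δ) * q ρ ≤ Real.log (‖1 - ρ‖ / ‖s0 - ρ‖) ∧
      Real.log (‖1 - ρ‖ / ‖s0 - ρ‖) ≤ 0 := by
    intro ρ hρ
    rw [hqeq]
    exact zero_log_bound hδ (hre1 ρ hρ) (haway ρ hρ)
  have hub : ∑ ρ ∈ S, (m ρ : ℝ) * Real.log (‖1 - ρ‖ / ‖s0 - ρ‖) ≤ 0 :=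
    Finset.sum_nonpos fun ρ hρ => mul_nonpos_of_nonneg_of_nonpos (by positivity) (hone ρ hρ).2
  have hlb : -(36 * δ) * (12 / 10 / δ) ≤ ∑ ρ ∈ S, (m ρ : ℝ) * Real.log (‖1 - ρ‖ / ‖s0 - ρ‖) := by
    calc -(36 * δ) * (12 / 10 / δ) ≤ -(36 * δ) * ∑ ρ ∈ S, (m ρ : ℝ) * q ρ := by
          apply mul_le_mul_of_nonpos_left hsum
          linarith
      _ = ∑ ρ ∈ S, (m ρ : ℝ) * (-(36 * δ) * q ρ) := by
          rw [Finset.mul_sum]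
          exact Finset.sum_congr rfl fun ρ _ => by ring
      _ ≤ _ := Finset.sum_le_sum fun ρ hρ => mul_le_mul_of_nonneg_left (hone ρ hρ).1 (by positivity)
  have hval : -(36 * δ) * (12 / 10 / δ) = -(432 / 10) := by field_simp; norm_num
  rw [hval] at hlb
  rw [abs_le] at he' ⊢
  constructor <;> linarith [he'.1, he'.2]

end PartD

section PartE

open Filter Topology

lemma prime_term_bound {d : ℕ} (χ : DirichletCharacter ℂ d) {δ : ℝ} (hδ : 0 < δ)
    {p : ℕ} (hp : p.Prime) :
    |(-Complex.log (1 - χ p * (p : ℂ) ^ (-((1 + δ : ℝ) : ℂ)))).re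
      - (χ p).re * (p : ℝ) ^ (-(1 + δ))| ≤ ((p : ℝ) ^ 2)⁻¹ := by
  have hp0 : (0 : ℝ) < p := by exact_mod_cast hp.pos
  have hp2 : (2 : ℝ) ≤ p := by exact_mod_cast hp.two_le
  have hcast : (p : ℂ) ^ (-((1 + δ : ℝ) : ℂ)) = (((p : ℝ) ^ (-(1 + δ)) : ℝ) : ℂ) := by
    rw [Complex.ofReal_cpow hp0.le]; push_cast; rfl
  set z : ℂ := χ p * (p : ℂ) ^ (-((1 + δ : ℝ) : ℂ)) with hz
  have hzre : z.re = (χ p).re * (p : ℝ) ^ (-(1 + δ)) := by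
    rw [hz, hcast, Complex.re_mul_ofReal]
  have hzn : ‖z‖ ≤ (p : ℝ)⁻¹ := by
    rw [hz, hcast, norm_mul, Complex.norm_real, Real.norm_of_nonneg (by positivity)]
    calc ‖χ p‖ * (p : ℝ) ^ (-(1 + δ)) ≤ 1 * (p : ℝ) ^ (-1 : ℝ) := by
          gcongr
          · exact χ.norm_le_one _
          · linarith
          · linarith
      _ = _ := by rw [Real.rpow_neg_one, one_mul]
  have hinv : (p : ℝ)⁻¹ ≤ 1 / 2 := by
    rw [inv_eq_one_div]; gcongr
  have hz1 : ‖-z‖ < 1 := by rw [norm_neg]; linarith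
  have h := Complex.norm_log_one_add_sub_self_le hz1
  rw [norm_neg, ← sub_eq_add_neg, sub_neg_eq_add] at h
  rw [← hzre, ← Complex.sub_re]
  refine (Complex.abs_re_le_norm _).trans ?_
  rw [← norm_neg, show -(-Complex.log (1 - z) - z) = Complex.log (1 - z) + z by ring]
  refine h.trans ?_
  have h2 : (1 - ‖z‖)⁻¹ ≤ 2 := by
    rw [inv_le_comm₀ (by linarith) (by norm_num)]; linarith
  have h3 : ‖z‖ ^ 2 ≤ ((p : ℝ)⁻¹) ^ 2 := by gcongr
  rw [inv_pow] at h3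
  have h0 : 0 ≤ (1 - ‖z‖)⁻¹ := by rw [inv_nonneg]; linarith
  nlinarith [sq_nonneg ‖z‖]

lemma prime_cut_bound {δ : ℝ} (hδ : 0 < δ) {N p : ℕ} (hp : p.Prime)
    (h1 : p < N → δ * Real.log p ≤ 1 / 2) (h2 : N ≤ p → 1 / 2 ≤ δ * Real.log p) :
    |(p : ℝ) ^ (-(1 + δ)) - (if p < N then (p : ℝ)⁻¹ else 0)| ≤
      2 * δ * (Real.log p * (p : ℝ) ^ (-(1 + δ))) := by
  have hp0 : (0 : ℝ) < p := by exact_mod_cast hp.pos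
  have hp2 : (1 : ℝ) ≤ p := by exact_mod_cast hp.one_le
  have hr : 0 < (p : ℝ) ^ (-(1 + δ)) := by positivity
  have hl : 0 ≤ Real.log p := Real.log_nonneg hp2
  split_ifs with h
  · have h3 : (p : ℝ)⁻¹ = (p : ℝ) ^ (-(1 + δ)) * Real.exp (δ * Real.log p) := by
      rw [mul_comm δ, ← Real.rpow_def_of_pos hp0, ← Real.rpow_add hp0, ← Real.rpow_neg_one]
      congr 1; ring
    have h4 := Real.abs_exp_sub_one_le (x := δ * Real.log p) (by
      rw [abs_of_nonneg (by positivity)]; linarith [h1 h])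
    rw [abs_of_nonneg (a := δ * Real.log p) (by positivity)] at h4
    rw [h3, show (p : ℝ) ^ (-(1 + δ)) - (p : ℝ) ^ (-(1 + δ)) * Real.exp (δ * Real.log p)
      = -((p : ℝ) ^ (-(1 + δ)) * (Real.exp (δ * Real.log p) - 1)) by ring, abs_neg, abs_mul,
      abs_of_pos hr]
    nlinarith
  · have := h2 (not_lt.1 h)
    rw [sub_zero, abs_of_pos hr]
    nlinarith

lemma prime_sum_compare {d : ℕ} [NeZero d] (χ : DirichletCharacter ℂ d) {δ : ℝ} (hδ : 0 < δ)
    (hvm : ∑' n : ℕ, ArithmeticFunction.vonMangoldt n * (n : ℝ) ^ (-(1 + δ)) ≤ 11 / 10 / δ)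
    {N : ℕ} (h1 : ∀ p, p.Prime → p < N → δ * Real.log p ≤ 1 / 2)
    (h2 : ∀ p, p.Prime → N ≤ p → 1 / 2 ≤ δ * Real.log p) :
    |Real.log ‖χ.LFunction ((1 + δ : ℝ) : ℂ)‖ -
      ∑ p ∈ (Finset.range N).filter Nat.Prime, (χ p).re / (p : ℝ)| ≤
      ∑' n : ℕ, ((n : ℝ) ^ 2)⁻¹ + 3 := by
  classical
  have hre : 1 < (((1 + δ : ℝ) : ℂ)).re := by simpa using hδ
  have hS := DirichletCharacter.summable_neg_log_one_sub_mul_prime_cpow χ hre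
  have hlogL : Real.log ‖χ.LFunction ((1 + δ : ℝ) : ℂ)‖ =
      (∑' p : Nat.Primes, -Complex.log (1 - χ p * (p : ℂ) ^ (-((1 + δ : ℝ) : ℂ)))).re := by
    rw [DirichletCharacter.LFunction_eq_LSeries χ hre,
      ← DirichletCharacter.LSeries_eulerProduct_exp_log χ hre, Complex.norm_exp, Real.log_exp]
  have hA0 := Complex.hasSum_re hS.hasSum
  rw [← hlogL] at hA0
  set g : ℕ → ℝ := fun n => (-Complex.log (1 - χ n * (n : ℂ) ^ (-((1 + δ : ℝ) : ℂ)))).re with hg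
  have hA : HasSum ({p : ℕ | p.Prime}.indicator g) (Real.log ‖χ.LFunction ((1 + δ : ℝ) : ℂ)‖) :=
    hasSum_subtype_iff_indicator.1 hA0
  set b : ℕ → ℝ := fun n => if n ∈ (Finset.range N).filter Nat.Prime then (χ n).re / (n : ℝ) else 0
    with hb
  have hB : HasSum b (∑ p ∈ (Finset.range N).filter Nat.Prime, (χ p).re / (p : ℝ)) := by
    have h := hasSum_sum_of_ne_finset_zero (L := SummationFilter.unconditional ℕ) (f := b) (s := (Finset.range N).filter Nat.Prime)
      (fun n hn => by simp only [hb]; rw [if_neg hn])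
    convert h using 1
    refine Finset.sum_congr rfl fun p hp => ?_
    simp only [hb]; rw [if_pos hp]
  have hD := hA.sub hB
  have hsq : Summable (fun n : ℕ => ((n : ℝ) ^ 2)⁻¹) := by
    simpa using (Real.summable_nat_pow_inv (p := 2)).2 (by norm_num)
  have hG := hsq.hasSum.add ((vm_summable hδ).hasSum.mul_left (2 * δ))
  have hfin := tsum_of_norm_bounded hG (f := fun n => {p : ℕ | p.Prime}.indicator g n - b n) (by
    intro n
    rw [Real.norm_eq_abs]
    by_cases hn : n.Prime
    · rw [Set.indicator_of_mem (show n ∈ {p : ℕ | p.Prime} from hn),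
        ArithmeticFunction.vonMangoldt_apply_prime hn]
      have hbn : b n = (χ n).re * (if n < N then (n : ℝ)⁻¹ else 0) := by
        simp only [hb, Finset.mem_filter, Finset.mem_range, hn, and_true]
        split_ifs <;> simp [div_eq_mul_inv]
      have e1 := prime_term_bound χ hδ hn
      have e2 := prime_cut_bound hδ hn (h1 n hn) (h2 n hn)
      have e3 : |(χ n).re| ≤ 1 := (Complex.abs_re_le_norm _).trans (χ.norm_le_one _)
      have e4 : |(χ n).re * (n : ℝ) ^ (-(1 + δ)) - b n| ≤
          2 * δ * (Real.log n * (n : ℝ) ^ (-(1 + δ))) := by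
        rw [hbn, ← mul_sub, abs_mul]
        refine le_trans ?_ e2
        exact mul_le_of_le_one_left (abs_nonneg _) e3
      exact (abs_sub_le _ _ _).trans (add_le_add e1 e4)
    · rw [Set.indicator_of_notMem (show n ∉ {p : ℕ | p.Prime} from hn)]
      have hbn : b n = 0 := by
        simp only [hb, Finset.mem_filter, hn, and_false, if_false]
      rw [hbn, sub_zero, abs_zero]
      have := ArithmeticFunction.vonMangoldt_nonneg (n := n)
      positivity)
  rw [hD.tsum_eq, Real.norm_eq_abs] at hfin
  refine hfin.trans ?_
  have : 2 * δ * ∑' n : ℕ, ArithmeticFunction.vonMangoldt n * (n : ℝ) ^ (-(1 + δ)) ≤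
      2 * δ * (11 / 10 / δ) := by gcongr
  have h5 : 2 * δ * (11 / 10 / δ) = 22 / 10 := by field_simp; norm_num
  linarith

lemma prime_log_sum {δ : ℝ} (hδ : 0 < δ)
    (hvm : ∑' n : ℕ, ArithmeticFunction.vonMangoldt n * (n : ℝ) ^ (-(1 + δ)) ≤ 11 / 10 / δ)
    {N : ℕ} (h1 : ∀ p, p.Prime → p < N → δ * Real.log p ≤ 1 / 2) :
    ∑ p ∈ (Finset.range N).filter Nat.Prime, Real.log p / (p : ℝ) ≤ 3 / δ := by
  have hs := (vm_summable hδ).mul_left 2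
  have h2 := hs.sum_le_tsum ((Finset.range N).filter Nat.Prime) (fun n _ => by
    have := ArithmeticFunction.vonMangoldt_nonneg (n := n)
    positivity)
  rw [tsum_mul_left] at h2
  have h3 : ∑ p ∈ (Finset.range N).filter Nat.Prime, Real.log p / (p : ℝ) ≤
      ∑ n ∈ (Finset.range N).filter Nat.Prime,
        2 * (ArithmeticFunction.vonMangoldt n * (n : ℝ) ^ (-(1 + δ))) := by
    refine Finset.sum_le_sum fun p hp => ?_
    rw [Finset.mem_filter, Finset.mem_range] at hp
    rw [ArithmeticFunction.vonMangoldt_apply_prime hp.2]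
    have hp0 : (0 : ℝ) < p := by exact_mod_cast hp.2.pos
    have hl : 0 ≤ Real.log p := Real.log_nonneg (by exact_mod_cast hp.2.one_le)
    have h3 : (p : ℝ)⁻¹ = (p : ℝ) ^ (-(1 + δ)) * Real.exp (δ * Real.log p) := by
      rw [mul_comm δ, ← Real.rpow_def_of_pos hp0, ← Real.rpow_add hp0, ← Real.rpow_neg_one]
      congr 1; ring
    have h5 := h1 p hp.2 hp.1
    have h4 := Real.abs_exp_sub_one_le (x := δ * Real.log p) (by
      rw [abs_of_nonneg (by positivity)]; linarith)
    rw [abs_of_nonneg (a := δ * Real.log p) (by positivity)] at h4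
    have h6 : Real.exp (δ * Real.log p) ≤ 2 := by linarith [(abs_le.1 h4).2]
    rw [div_eq_mul_inv, h3]
    have : 0 ≤ Real.log p * (p : ℝ) ^ (-(1 + δ)) := by positivity
    nlinarith
  have h7 : 2 * (11 / 10 / δ) ≤ 3 / δ := by
    rw [div_div, ← mul_div_assoc, div_le_div_iff₀ (by positivity) hδ]; nlinarith
  linarith

end PartE

section PartF

open Filter Topology MeasureTheory

lemma chi_zero {d : ℕ} [NeZero d] {χ : DirichletCharacter ℂ d} (hχ : χ ≠ 1) :
    χ ((0 : ℕ) : ZMod d) = 0 := by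
  have hd : d ≠ 1 := by
    rintro rfl
    exact hχ (Subsingleton.elim _ _)
  rw [Nat.cast_zero]
  have : Nontrivial (ZMod d) := ZMod.nontrivial_iff.2 hd
  exact MulChar.map_zero χ

lemma T_tail {d : ℕ} [NeZero d] {χ : DirichletCharacter ℂ d} (hχ : χ ≠ 1) {m : ℕ} (hm : 1 ≤ m) :
    ‖(∑ k ∈ Finset.Ioc 0 m, χ (k : ZMod d) / (k : ℂ)) - χ.LFunction 1‖ ≤ 2 * d / m := by
  have hm1 : (1 : ℝ) ≤ m := by exact_mod_cast hm
  have hm0 : (0 : ℝ) < m := by linarith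
  have hS : ∀ n : ℕ, ∑ k ∈ Finset.Icc 0 n, χ (k : ZMod d) = ∑ k ∈ Finset.Icc 1 n, χ (k : ZMod d) := by
    intro n
    rw [Finset.Icc_eq_cons_Ioc (Nat.zero_le n), Finset.sum_cons, chi_zero hχ, zero_add]
    rfl
  have hder : ∀ t : ℝ, t ≠ 0 → HasDerivAt (fun t : ℝ => ((t : ℂ))⁻¹) (-((t : ℂ) ^ 2)⁻¹) t := by
    intro t ht
    have h1 := (hasDerivAt_inv (x := (t : ℂ)) (by exact_mod_cast ht)).comp_ofReal
    exact h1
  have hderiv : ∀ t ∈ Set.Icc (1 : ℝ) m, deriv (fun t : ℝ => ((t : ℂ))⁻¹) t = -((t : ℂ) ^ 2)⁻¹ :=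
    fun t ht => (hder t (by have := ht.1; linarith)).deriv
  have hcont : ContinuousOn (fun t : ℝ => -((t : ℂ) ^ 2)⁻¹) (Set.Icc (1 : ℝ) m) := by
    refine ContinuousOn.neg (ContinuousOn.inv₀ (by fun_prop) ?_)
    intro t ht
    have : t ≠ 0 := by have := ht.1; linarith
    exact pow_ne_zero 2 (by exact_mod_cast this)
  have hA := sum_mul_eq_sub_integral_mul₀' (f := fun t : ℝ => ((t : ℂ))⁻¹)
    (fun k : ℕ => χ (k : ZMod d)) (chi_zero hχ) m
    (fun t ht => (hder t (by have := ht.1; linarith)).differentiableAt)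
    (by
      refine IntegrableOn.congr_fun (hcont.integrableOn_Icc) ?_ measurableSet_Icc
      intro t ht
      exact (hderiv t ht).symm)
  have hT : ∑ k ∈ Finset.Icc 0 m, (((k : ℝ) : ℂ))⁻¹ * χ (k : ZMod d) =
      ∑ k ∈ Finset.Ioc 0 m, χ (k : ZMod d) / (k : ℂ) := by
    rw [Finset.Icc_eq_cons_Ioc (Nat.zero_le m), Finset.sum_cons, chi_zero hχ, mul_zero, zero_add]
    refine Finset.sum_congr rfl fun k _ => ?_
    rw [Complex.ofReal_natCast, div_eq_mul_inv, mul_comm]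
  have hI : ∫ t in Set.Ioc (1 : ℝ) m, deriv (fun t : ℝ => ((t : ℂ))⁻¹) t *
      ∑ k ∈ Finset.Icc 0 ⌊t⌋₊, χ (k : ZMod d) =
      -∫ t in Set.Ioc (1 : ℝ) m, chiS χ t * (t : ℂ) ^ (-((1 : ℂ) + 1)) := by
    rw [← integral_neg]
    refine setIntegral_congr_fun measurableSet_Ioc ?_
    intro t ht
    have ht' : t ∈ Set.Icc (1 : ℝ) m := ⟨ht.1.le, ht.2⟩
    simp only
    rw [hderiv t ht', hS, chiS, Complex.cpow_neg, show ((1 : ℂ) + 1) = ((2 : ℕ) : ℂ) by norm_num,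
      Complex.cpow_natCast]
    ring
  have hL := LFunction_eq_integral hχ (s := 1) (by norm_num)
  obtain ⟨ht1, -⟩ := chi_integral_tail_le hχ (s := 1) (by norm_num) (T := 1) (by norm_num)
  obtain ⟨-, htm⟩ := chi_integral_tail_le hχ (s := 1) (by norm_num) (T := m) (by linarith)
  have hsplit : ∫ t in Set.Ioi (1 : ℝ), chiS χ t * (t : ℂ) ^ (-((1 : ℂ) + 1)) =
      (∫ t in Set.Ioc (1 : ℝ) m, chiS χ t * (t : ℂ) ^ (-((1 : ℂ) + 1))) +
      ∫ t in Set.Ioi (m : ℝ), chiS χ t * (t : ℂ) ^ (-((1 : ℂ) + 1)) := by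
    rw [← setIntegral_union Set.Ioc_disjoint_Ioi_same measurableSet_Ioi
      (ht1.mono_set Set.Ioc_subset_Ioi_self) (ht1.mono_set (Set.Ioi_subset_Ioi hm1)),
      Set.Ioc_union_Ioi_eq_Ioi hm1]
  rw [hT, hI, hS] at hA
  rw [hA, hL, hsplit, one_mul]
  have hb1 := chi_sum_Icc_le hχ m
  have hb2 : ‖(((m : ℝ) : ℂ))⁻¹ * ∑ k ∈ Finset.Icc 1 m, χ (k : ZMod d)‖ ≤ d / m := by
    rw [norm_mul, norm_inv, Complex.norm_real, Real.norm_of_nonneg hm0.le, div_eq_inv_mul]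
    gcongr
  have hb3 : (d : ℝ) * (m : ℝ) ^ (-(1 : ℂ).re) / (1 : ℂ).re = d / m := by
    rw [Complex.one_re, Real.rpow_neg_one, div_one, div_eq_mul_inv]
  rw [hb3] at htm
  have : ∀ a b c : ℂ, a - -b - (b + c) = a - c := by intros; ring
  rw [this]
  refine (norm_sub_le _ _).trans ?_
  have : 2 * (d : ℝ) / m = d / m + d / m := by ring
  linarith

lemma chi_log_bdd {d : ℕ} [NeZero d] {χ : DirichletCharacter ℂ d} (hχ : χ ≠ 1) :
    ∃ B : ℝ, ∀ N : ℕ, ‖∑ n ∈ Finset.range N, χ (n : ZMod d) * (Real.log n : ℂ) / (n : ℂ)‖ ≤ B := by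
  set f : ℕ → ℝ := fun n => Real.log (max n 3 : ℕ) / ((max n 3 : ℕ) : ℝ) with hf
  have he : Real.exp 1 ≤ 3 := by have := Real.exp_one_lt_d9; linarith
  have hanti : Antitone f := by
    intro a b hab
    have h3 : ∀ n : ℕ, (3 : ℝ) ≤ ((max n 3 : ℕ) : ℝ) := fun n => by
      exact_mod_cast le_max_right n 3
    exact Real.log_div_self_antitoneOn (show Real.exp 1 ≤ _ from he.trans (h3 a))
      (show Real.exp 1 ≤ _ from he.trans (h3 b)) (by exact_mod_cast max_le_max_right 3 hab)
  have h0 : Tendsto f atTop (𝓝 0) := by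
    have h1 : Tendsto (fun x : ℝ => Real.log x / x) atTop (𝓝 0) := by
      simpa using Real.isLittleO_log_id_atTop.tendsto_div_nhds_zero
    refine (h1.comp tendsto_natCast_atTop_atTop).congr' ?_
    filter_upwards [eventually_ge_atTop 3] with n hn
    simp only [hf, Function.comp_apply, max_eq_left hn]
  have hC := hanti.cauchySeq_series_mul_of_tendsto_zero_of_bounded h0
    (z := fun n : ℕ => χ (n : ZMod d)) (b := d) (fun n => chi_sum_range_le hχ n)
  set g : ℕ → ℂ := fun n => χ (n : ZMod d) * (Real.log n : ℂ) / (n : ℂ) - f n • χ (n : ZMod d)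
    with hg
  have hgs : Summable g := by
    refine summable_of_ne_finset_zero (s := Finset.range 3) ?_
    intro n hn
    rw [Finset.mem_range, not_lt] at hn
    simp only [hg, hf, max_eq_left hn]
    rw [Complex.real_smul]
    push_cast
    ring
  have hC2 := hgs.hasSum.tendsto_sum_nat.cauchySeq
  have hC3 := hC.add hC2
  obtain ⟨B, hB⟩ := hC3.norm_bddAbove
  refine ⟨B, fun N => ?_⟩
  have h := hB (Set.mem_range_self N)
  refine le_trans (le_of_eq ?_) h
  simp only [Pi.add_apply, ← Finset.sum_add_distrib]
  congr 1
  refine Finset.sum_congr rfl fun n _ => ?_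
  simp only [hg]
  ring

end PartF

section PartG

open Filter Topology

lemma chi_vm_bdd {d : ℕ} [NeZero d] {χ : DirichletCharacter ℂ d} (hχ : χ ≠ 1) :
    ∃ B : ℝ, ∀ N : ℕ, ‖∑ n ∈ Finset.Ioc 0 N,
      χ (n : ZMod d) * (ArithmeticFunction.vonMangoldt n : ℂ) / (n : ℂ)‖ ≤ B := by
  obtain ⟨B, hB⟩ := chi_log_bdd hχ
  have hL1 : χ.LFunction 1 ≠ 0 := DirichletCharacter.LFunction_apply_one_ne_zero hχ
  set f : ArithmeticFunction ℂ :=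
    ⟨fun n => χ (n : ZMod d) * (ArithmeticFunction.vonMangoldt n : ℂ) / (n : ℂ), by simp⟩ with hf
  set g : ArithmeticFunction ℂ := ⟨fun n => χ (n : ZMod d) / (n : ℂ), by simp⟩ with hg
  have hfv : ∀ n, f n = χ (n : ZMod d) * (ArithmeticFunction.vonMangoldt n : ℂ) / (n : ℂ) :=
    fun n => rfl
  have hgv : ∀ n, g n = χ (n : ZMod d) / (n : ℂ) := fun n => rfl
  have hfg : ∀ n, (f * g) n = χ (n : ZMod d) * (Real.log n : ℂ) / (n : ℂ) := by
    intro n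
    rw [ArithmeticFunction.mul_apply, ← ArithmeticFunction.vonMangoldt_sum,
      ← Nat.sum_divisorsAntidiagonal (fun a _ => ArithmeticFunction.vonMangoldt a),
      Complex.ofReal_sum, Finset.mul_sum, Finset.sum_div]
    refine Finset.sum_congr rfl fun ab hab => ?_
    have h := (Nat.mem_divisorsAntidiagonal.1 hab).1
    rw [hfv, hgv, ← h]
    push_cast
    rw [map_mul]
    rw [div_mul_div_comm]
    ring
  set D : ℝ := 4 * d * (Real.log 4 + 4) with hD
  refine ⟨(B + D) / ‖χ.LFunction 1‖, fun N => ?_⟩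
  rw [le_div_iff₀ (norm_pos_iff.2 hL1), ← norm_mul]
  have hsum := ArithmeticFunction.sum_Ioc_mul_eq_sum_sum f g N
  have hlhs : ‖∑ n ∈ Finset.Ioc 0 N, (f * g) n‖ ≤ B := by
    refine le_trans (le_of_eq ?_) (hB (N + 1))
    congr 1
    rw [Finset.range_eq_Ico, Finset.sum_eq_sum_Ico_succ_bot (by omega), Nat.cast_zero, Nat.cast_zero,
      Nat.cast_zero, div_zero, zero_add]
    exact Finset.sum_congr (by ext; simp; omega) fun n _ => hfg n
  have herr : ‖(∑ n ∈ Finset.Ioc 0 N, f n * ∑ m ∈ Finset.Ioc 0 (N / n), g m) -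
      (∑ n ∈ Finset.Ioc 0 N, f n) * χ.LFunction 1‖ ≤ D := by
    rw [Finset.sum_mul, ← Finset.sum_sub_distrib]
    rcases Nat.eq_zero_or_pos N with rfl | hN
    · have : 0 ≤ Real.log 4 := Real.log_nonneg (by norm_num)
      simp [hD]; positivity
    have hN0 : (0 : ℝ) < N := by exact_mod_cast hN
    have hterm : ∀ n ∈ Finset.Ioc 0 N, ‖f n * (∑ m ∈ Finset.Ioc 0 (N / n), g m) -
        f n * χ.LFunction 1‖ ≤ ArithmeticFunction.vonMangoldt n * (4 * d / N) := by
      intro n hn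
      rw [Finset.mem_Ioc] at hn
      have hn0 : (0 : ℝ) < n := by exact_mod_cast hn.1
      have hq : 1 ≤ N / n := (Nat.one_le_div_iff hn.1).2 hn.2
      have hq' : (1 : ℝ) ≤ ((N / n : ℕ) : ℝ) := by exact_mod_cast hq
      have ht := T_tail hχ hq
      rw [← mul_sub, norm_mul]
      have h1 : ‖f n‖ ≤ ArithmeticFunction.vonMangoldt n / n := by
        rw [hfv, norm_div, norm_mul, Complex.norm_natCast, Complex.norm_real,
          Real.norm_of_nonneg ArithmeticFunction.vonMangoldt_nonneg]
        gcongr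
        exact mul_le_of_le_one_left ArithmeticFunction.vonMangoldt_nonneg (χ.norm_le_one _)
      have h2 : 2 * (d : ℝ) / ((N / n : ℕ) : ℝ) ≤ 4 * d * n / N := by
        have h3 : (N : ℝ) ≤ 2 * n * ((N / n : ℕ) : ℝ) := by
          have h4 : N < n * (N / n) + n := by
            have := Nat.div_add_mod N n
            have := Nat.mod_lt N hn.1
            omega
          have h5 : (N : ℝ) ≤ n * ((N / n : ℕ) : ℝ) + n := by exact_mod_cast h4.le
          nlinarith
        rw [div_le_div_iff₀ (by linarith) hN0]
        have : (0 : ℝ) ≤ 2 * d := by positivity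
        nlinarith
      calc ‖f n‖ * ‖(∑ m ∈ Finset.Ioc 0 (N / n), g m) - χ.LFunction 1‖
          ≤ (ArithmeticFunction.vonMangoldt n / n) * (4 * d * n / N) := by
            refine mul_le_mul h1 (ht.trans h2) (norm_nonneg _) ?_
            exact div_nonneg ArithmeticFunction.vonMangoldt_nonneg hn0.le
        _ = _ := by field_simp
    refine (norm_sum_le_of_le _ hterm).trans ?_
    rw [← Finset.sum_mul]
    have hpsi := Chebyshev.psi_le_const_mul_self (x := N) hN0.le
    rw [Chebyshev.psi, Nat.floor_natCast] at hpsi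
    calc _ ≤ (Real.log 4 + 4) * N * (4 * d / N) := by gcongr
      _ = D := by rw [hD]; field_simp
  rw [← hsum] at herr
  have hfs : ∑ n ∈ Finset.Ioc 0 N,
      χ (n : ZMod d) * (ArithmeticFunction.vonMangoldt n : ℂ) / (n : ℂ) = ∑ n ∈ Finset.Ioc 0 N, f n := rfl
  rw [hfs]
  have := norm_sub_le (∑ n ∈ Finset.Ioc 0 N, (f * g) n)
    ((∑ n ∈ Finset.Ioc 0 N, (f * g) n) - (∑ n ∈ Finset.Ioc 0 N, f n) * χ.LFunction 1)
  rw [sub_sub_cancel] at this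
  linarith

lemma nonprime_summable :
    Summable fun n : ℕ => (if n.Prime then 0 else ArithmeticFunction.vonMangoldt n) / (n : ℝ) := by
  have h := ArithmeticFunction.vonMangoldt.summable_residueClass_non_primes_div (q := 1) 0
  refine h.congr fun n => ?_
  congr 2
  rw [ArithmeticFunction.vonMangoldt.residueClass, Set.indicator_of_mem]
  exact Subsingleton.elim (α := ZMod 1) _ _

lemma chi_primelog_bdd {d : ℕ} [NeZero d] {χ : DirichletCharacter ℂ d} (hχ : χ ≠ 1) :
    ∃ B : ℝ, ∀ N : ℕ, ‖∑ n ∈ Finset.range N,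
      (if n.Prime then χ (n : ZMod d) * (Real.log n : ℂ) / (n : ℂ) else 0)‖ ≤ B := by
  obtain ⟨B, hB⟩ := chi_vm_bdd hχ
  have hB0 : 0 ≤ B := (norm_nonneg _).trans (hB 0)
  set h : ℕ → ℝ := fun n => (if n.Prime then 0 else ArithmeticFunction.vonMangoldt n) / (n : ℝ) with hh
  have hs : Summable h := nonprime_summable
  have hpos : ∀ n, 0 ≤ h n := by
    intro n
    simp only [hh]
    split_ifs
    · simp
    · exact div_nonneg ArithmeticFunction.vonMangoldt_nonneg (by positivity)
  refine ⟨B + ∑' n, h n, fun N => ?_⟩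
  rcases Nat.eq_zero_or_pos N with rfl | hN
  · have : 0 ≤ ∑' n, h n := tsum_nonneg hpos
    simp only [Finset.range_zero, Finset.sum_empty, norm_zero]
    linarith
  have e1 : ∑ n ∈ Finset.Ioc 0 (N - 1),
      χ (n : ZMod d) * (ArithmeticFunction.vonMangoldt n : ℂ) / (n : ℂ) =
      ∑ n ∈ Finset.range N, χ (n : ZMod d) * (ArithmeticFunction.vonMangoldt n : ℂ) / (n : ℂ) := by
    rw [Finset.range_eq_Ico, Finset.sum_eq_sum_Ico_succ_bot hN, Nat.cast_zero, Nat.cast_zero,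
      div_zero, zero_add]
    exact Finset.sum_congr (by ext; simp; omega) fun n _ => rfl
  have e2 : ∑ n ∈ Finset.range N,
      (if n.Prime then χ (n : ZMod d) * (Real.log n : ℂ) / (n : ℂ) else 0) =
      (∑ n ∈ Finset.range N, χ (n : ZMod d) * (ArithmeticFunction.vonMangoldt n : ℂ) / (n : ℂ)) -
      ∑ n ∈ Finset.range N, χ (n : ZMod d) * (h n : ℂ) := by
    rw [← Finset.sum_sub_distrib]
    refine Finset.sum_congr rfl fun n _ => ?_
    simp only [hh]
    split_ifs with hp
    · rw [ArithmeticFunction.vonMangoldt_apply_prime hp]; simp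
    · push_cast; ring
  rw [e2, ← e1]
  refine (norm_sub_le _ _).trans (add_le_add (hB _) ?_)
  refine (norm_sum_le_of_le _ (f := fun n : ℕ => χ (n : ZMod d) * (h n : ℂ)) (n := h) ?_).trans
    (hs.sum_le_tsum _ fun n _ => hpos n)
  intro n _
  rw [norm_mul, Complex.norm_real, Real.norm_of_nonneg (hpos n)]
  exact mul_le_of_le_one_left (hpos n) (χ.norm_le_one _)

lemma curly_exists {d : ℕ} [NeZero d] {χ : DirichletCharacter ℂ d} (hχ : χ ≠ 1) :
    ∃ L : ℝ, Tendsto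
      (fun y : ℕ => ∑ p ∈ (Finset.range y).filter Nat.Prime, (χ p).re / (p : ℝ)) atTop (𝓝 L) := by
  obtain ⟨B, hB⟩ := chi_primelog_bdd hχ
  set f : ℕ → ℝ := fun n => (Real.log (max n 2 : ℕ))⁻¹ with hf
  have h2 : ∀ n : ℕ, (2 : ℝ) ≤ ((max n 2 : ℕ) : ℝ) := fun n => by
    exact_mod_cast le_max_right n 2
  have hanti : Antitone f := by
    intro a b hab
    have hl := Real.log_pos (show (1 : ℝ) < ((max a 2 : ℕ) : ℝ) by linarith [h2 a])
    refine inv_anti₀ hl (Real.log_le_log (by linarith [h2 a]) ?_)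
    exact_mod_cast max_le_max_right 2 hab
  have h0 : Tendsto f atTop (𝓝 0) := by
    refine ((tendsto_inv_atTop_zero.comp Real.tendsto_log_atTop).comp
      tendsto_natCast_atTop_atTop).congr' ?_
    filter_upwards [eventually_ge_atTop 2] with n hn
    simp only [hf, Function.comp_apply, max_eq_left hn]
  have hC := hanti.cauchySeq_series_mul_of_tendsto_zero_of_bounded h0 hB
  obtain ⟨z, hz⟩ := cauchySeq_tendsto_of_complete hC
  refine ⟨z.re, ?_⟩
  refine ((Complex.continuous_re.tendsto z).comp hz).congr fun N => ?_
  simp only [Function.comp_apply]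
  rw [Complex.re_sum, Finset.sum_filter]
  refine Finset.sum_congr rfl fun n _ => ?_
  split_ifs with hp
  · have hl := Real.log_pos (show (1 : ℝ) < (n : ℝ) by exact_mod_cast hp.one_lt)
    simp only [hf, max_eq_left hp.two_le]
    rw [Complex.real_smul, Complex.re_ofReal_mul, ← Complex.ofReal_natCast, Complex.div_ofReal_re,
      Complex.re_mul_ofReal]
    field_simp
  · simp

end PartG

section PartH

open Filter Topology


lemma Li_bound : ∃ A > (0 : ℝ), ∀ᶠ y : ℝ in atTop,
    |Li y - y / Real.log y| ≤ A * (y / Real.log y ^ 2) := by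
  obtain ⟨A, hA⟩ := Chebyshev.integral_one_div_log_sq_isBigO.bound
  have htop : Tendsto (fun y : ℝ => y / Real.log y ^ 2) atTop atTop := by
    have h1 : (fun y : ℝ => Real.log y ^ 2) =o[atTop] (id : ℝ → ℝ) :=
      Real.isLittleO_pow_log_id_atTop
    have h2 := h1.tendsto_div_nhds_zero
    have h3 : Tendsto (fun y : ℝ => Real.log y ^ 2 / id y) atTop (𝓝[>] 0) := by
      refine tendsto_nhdsWithin_iff.2 ⟨h2, ?_⟩
      filter_upwards [eventually_gt_atTop 1] with y hy
      have := Real.log_pos hy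
      have : (0 : ℝ) < id y := by simp only [id]; linarith
      exact Set.mem_Ioi.2 (by positivity)
    refine (tendsto_inv_nhdsGT_zero.comp h3).congr fun y => ?_
    simp
  refine ⟨|A| + 1, by positivity, ?_⟩
  filter_upwards [hA, htop.eventually_ge_atTop (2 / Real.log 2), eventually_ge_atTop 2]
    with y h1 h2 h3
  have hgt : ∀ t ∈ Set.uIcc (2 : ℝ) y, 1 < t := by
    intro t ht
    rw [Set.uIcc_of_le h3] at ht
    linarith [ht.1]
  have hl2 : 0 < Real.log 2 := Real.log_pos (by norm_num)
  have hi2 := Chebyshev.intervalIntegrable_one_div_log_sq (a := 2) (b := y) (by norm_num) (by linarith)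
  have hi1 : IntervalIntegrable (fun x : ℝ => 1 / Real.log x) MeasureTheory.volume 2 y := by
    refine ContinuousOn.intervalIntegrable fun t ht => ContinuousAt.continuousWithinAt ?_
    have h := hgt t ht
    have hl := Real.log_pos h
    exact continuousAt_const.div (Real.continuousAt_log (by linarith)) hl.ne'
  have hftc := intervalIntegral.integral_eq_sub_of_hasDerivAt (f := fun t : ℝ => t / Real.log t)
    (f' := fun t => 1 / Real.log t - 1 / Real.log t ^ 2) (a := 2) (b := y) (by
      intro t ht
      have h := hgt t ht
      have hl := Real.log_pos h
      refine ((hasDerivAt_id t).div (Real.hasDerivAt_log (by linarith)) hl.ne').congr_deriv ?_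
      simp only [id]
      have : t ≠ 0 := by linarith
      field_simp) (hi1.sub hi2)
  rw [intervalIntegral.integral_sub hi1 hi2] at hftc
  rw [Real.norm_eq_abs, Real.norm_eq_abs] at h1
  have hpos : 0 ≤ y / Real.log y ^ 2 := by positivity
  rw [abs_of_nonneg hpos] at h1
  have h4 : A * (y / Real.log y ^ 2) ≤ |A| * (y / Real.log y ^ 2) := by
    gcongr; exact le_abs_self A
  have h6 : Li y - y / Real.log y = (∫ t in (2:ℝ)..y, 1 / Real.log t ^ 2) - 2 / Real.log 2 := by
    rw [Li]; linarith
  rw [h6]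
  refine (abs_sub _ _).trans ?_
  rw [abs_of_pos (a := 2 / Real.log 2) (by positivity)]
  linarith

lemma Li_term {A x : ℝ} {p : ℕ} (hA : 0 < A) (hx : 1 < x) (hp : p.Prime)
    (hpx : Real.log p ≤ Real.log x / 2)
    (hLi : |Li (x / p) - (x / p) / Real.log (x / p)| ≤ A * ((x / p) / Real.log (x / p) ^ 2)) :
    |Li (x / p) - x / Real.log x / p| ≤
      (8 * A + 2) * (x / Real.log x ^ 2) * (Real.log p / p) := by
  have hp0 : (0 : ℝ) < p := by exact_mod_cast hp.pos
  have hlx : 0 < Real.log x := Real.log_pos hx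
  have hlp : 1 / 2 ≤ Real.log p := by
    have h1 : Real.log 2 ≤ Real.log p := Real.log_le_log (by norm_num) (by exact_mod_cast hp.two_le)
    have := Real.log_two_gt_d9
    linarith
  have hlq : Real.log (x / p) = Real.log x - Real.log p := Real.log_div (by linarith) hp0.ne'
  have hlq2 : Real.log x / 2 ≤ Real.log (x / p) := by rw [hlq]; linarith
  have hlq0 : 0 < Real.log (x / p) := by linarith
  have hxp : 0 < x / p := by positivity
  have e1 : A * ((x / p) / Real.log (x / p) ^ 2) ≤ 8 * A * (x / Real.log x ^ 2) * (Real.log p / p) := by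
    calc A * ((x / p) / Real.log (x / p) ^ 2) ≤ A * ((x / p) / (Real.log x / 2) ^ 2) := by gcongr
      _ = 8 * A * (x / Real.log x ^ 2) * ((1 / 2) / p) := by field_simp; norm_num
      _ ≤ _ := by gcongr
  have e2 : |(x / p) / Real.log (x / p) - x / Real.log x / p| ≤
      2 * (x / Real.log x ^ 2) * (Real.log p / p) := by
    have h1 : (x / p) / Real.log (x / p) - x / Real.log x / p =
        (x / p) * (Real.log p / (Real.log (x / p) * Real.log x)) := by
      rw [show Real.log p = Real.log x - Real.log (x / p) by rw [hlq]; ring]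
      field_simp
    rw [h1, abs_of_nonneg (by positivity)]
    calc (x / p) * (Real.log p / (Real.log (x / p) * Real.log x))
        ≤ (x / p) * (Real.log p / ((Real.log x / 2) * Real.log x)) := by gcongr
      _ = _ := by field_simp
  refine (abs_sub_le _ ((x / p) / Real.log (x / p)) _).trans ?_
  nlinarith [hLi.trans e1, e2]

end PartH

section PartI

open Topology

lemma cut_low {x : ℝ} {p : ℕ} (hp : 0 < p) (h : p < Nat.floor (Real.sqrt x) + 1) :
    (p : ℝ) ≤ Real.sqrt x ∧ Real.log p ≤ Real.log x / 2 := by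
  have hp0 : (0 : ℝ) < p := by exact_mod_cast hp
  have h1 : (p : ℝ) ≤ Real.sqrt x :=
    (Nat.le_floor_iff (Real.sqrt_nonneg x)).1 (Nat.lt_succ_iff.1 h)
  have hx : 0 < x := Real.sqrt_pos.1 (lt_of_lt_of_le hp0 h1)
  refine ⟨h1, ?_⟩
  rw [← Real.log_sqrt hx.le]
  exact Real.log_le_log hp0 h1

lemma cut_high {x : ℝ} (hx : 0 < x) {p : ℕ} (h : Nat.floor (Real.sqrt x) + 1 ≤ p) :
    Real.log x / 2 ≤ Real.log p := by
  have h1 : Real.sqrt x < p := (Nat.floor_lt (Real.sqrt_nonneg x)).1 h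
  rw [← Real.log_sqrt hx.le]
  exact Real.log_le_log (Real.sqrt_pos.2 hx) h1.le

lemma delta_tendsto : Tendsto (fun x : ℝ => (Real.log x)⁻¹) atTop (𝓝[>] 0) :=
  tendsto_inv_atTop_nhdsGT_zero.comp Real.tendsto_log_atTop

lemma prime_sum_compare_x : ∀ᶠ x : ℝ in atTop, ∀ (d : ℕ) [NeZero d] (χ : DirichletCharacter ℂ d),
    |Real.log ‖χ.LFunction ((1 + (Real.log x)⁻¹ : ℝ) : ℂ)‖ -
      ∑ p ∈ (Finset.range (Nat.floor (Real.sqrt x) + 1)).filter Nat.Prime, (χ p).re / (p : ℝ)| ≤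
      ∑' n : ℕ, ((n : ℝ) ^ 2)⁻¹ + 3 := by
  filter_upwards [delta_tendsto.eventually vm_bound, eventually_gt_atTop 1] with x h1 h2
  intro d _ χ
  have hl := Real.log_pos h2
  refine prime_sum_compare χ (inv_pos.2 hl) h1 ?_ ?_
  · intro p hp h
    have := (cut_low hp.pos h).2
    rw [inv_mul_le_iff₀ hl]; linarith
  · intro p hp h
    have := cut_high (by linarith) h
    rw [le_inv_mul_iff₀ hl]; linarith

lemma curly_near {d : ℕ} [NeZero d] {χ : DirichletCharacter ℂ d} (hχ : χ ≠ 1) {L : ℝ}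
    (hL : Tendsto (fun y : ℕ => ∑ p ∈ (Finset.range y).filter Nat.Prime, (χ p).re / (p : ℝ))
      atTop (𝓝 L)) :
    |Real.log ‖χ.LFunction 1‖ - L| ≤ ∑' n : ℕ, ((n : ℝ) ^ 2)⁻¹ + 3 := by
  have hL1 : χ.LFunction 1 ≠ 0 := DirichletCharacter.LFunction_apply_one_ne_zero hχ
  have ht1 : Tendsto (fun x : ℝ => Nat.floor (Real.sqrt x) + 1) atTop atTop :=
    (tendsto_add_atTop_nat 1).comp (tendsto_nat_floor_atTop.comp Real.tendsto_sqrt_atTop)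
  have ht2 := hL.comp ht1
  have ht3 : Tendsto (fun x : ℝ => (((1 + (Real.log x)⁻¹ : ℝ)) : ℂ)) atTop (𝓝 1) := by
    have h := (delta_tendsto.mono_right nhdsWithin_le_nhds).const_add (1 : ℝ)
    have h' := (Complex.continuous_ofReal.tendsto _).comp h
    simpa [Function.comp_def] using h'
  have ht4 : Tendsto (fun x : ℝ => Real.log ‖χ.LFunction ((1 + (Real.log x)⁻¹ : ℝ) : ℂ)‖) atTop
      (𝓝 (Real.log ‖χ.LFunction 1‖)) := by
    have hc := (DirichletCharacter.differentiable_LFunction hχ).continuous.tendsto 1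
    exact ((hc.comp ht3).norm).log (norm_ne_zero_iff.2 hL1)
  refine le_of_tendsto (ht4.sub ht2).abs ?_
  filter_upwards [prime_sum_compare_x] with x hx
  exact hx d χ

lemma size_cond : ∀ᶠ x : ℝ in atTop, 16 * (Real.log 8 + Real.sqrt (Real.log x) +
    Real.log (Real.log x)) ≤ 1 / 10 * Real.log x := by
  have h : ∀ᶠ u : ℝ in atTop, 16 * (Real.log 8 + Real.sqrt u + Real.log u) ≤ 1 / 10 * u := by
    have h1 : ∀ᶠ u : ℝ in atTop, ‖Real.log u‖ ≤ 1 / 1000 * ‖(id u : ℝ)‖ :=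
      Real.isLittleO_log_id_atTop.bound (by norm_num)
    filter_upwards [h1, eventually_ge_atTop ((1000 : ℝ) ^ 2), eventually_ge_atTop (1000 * Real.log 8)]
      with u h1 h2 h3
    have hu0 : 0 ≤ u := by linarith [h2, show (0 : ℝ) ≤ 1000 ^ 2 by norm_num]
    rw [Real.norm_eq_abs, Real.norm_eq_abs, id, abs_of_nonneg hu0] at h1
    have h4 := (le_abs_self _).trans h1
    have h5 : (1000 : ℝ) ≤ Real.sqrt u := Real.le_sqrt_of_sq_le h2
    have h6 := Real.mul_self_sqrt hu0
    nlinarith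
  exact Real.tendsto_log_atTop.eventually h

lemma sum_Li_bound : ∃ A > (0 : ℝ), ∀ᶠ x : ℝ in atTop, ∀ c : ℕ → ℝ, (∀ n, |c n| ≤ 1) →
    |∑ p ∈ (Finset.range (Nat.floor (Real.sqrt x) + 1)).filter Nat.Prime, c p * Li (x / (p : ℝ)) -
      x / Real.log x *
        ∑ p ∈ (Finset.range (Nat.floor (Real.sqrt x) + 1)).filter Nat.Prime, c p / (p : ℝ)| ≤
      A * (x / Real.log x) := by
  obtain ⟨A, hA, hLi⟩ := Li_bound
  obtain ⟨y0, hy0⟩ := eventually_atTop.1 hLi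
  refine ⟨(8 * A + 2) * 3, by positivity, ?_⟩
  filter_upwards [delta_tendsto.eventually vm_bound, eventually_gt_atTop 1,
    Real.tendsto_sqrt_atTop.eventually_ge_atTop y0] with x hvm hx1 hxy
  intro c hc
  have hl := Real.log_pos hx1
  have hx0 : 0 < x := by linarith
  have hsum := prime_log_sum (inv_pos.2 hl) hvm (N := Nat.floor (Real.sqrt x) + 1) (by
    intro p hp h
    have := (cut_low hp.pos h).2
    rw [inv_mul_le_iff₀ hl]; linarith)
  rw [Finset.mul_sum, ← Finset.sum_sub_distrib]
  refine (Finset.abs_sum_le_sum_abs _ _).trans ?_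
  calc ∑ p ∈ (Finset.range (Nat.floor (Real.sqrt x) + 1)).filter Nat.Prime,
        |c p * Li (x / (p : ℝ)) - x / Real.log x * (c p / (p : ℝ))|
      ≤ ∑ p ∈ (Finset.range (Nat.floor (Real.sqrt x) + 1)).filter Nat.Prime,
        (8 * A + 2) * (x / Real.log x ^ 2) * (Real.log p / p) := by
        refine Finset.sum_le_sum fun p hp => ?_
        rw [Finset.mem_filter, Finset.mem_range] at hp
        obtain ⟨h1, h2⟩ := cut_low hp.2.pos hp.1
        have hp0 : (0 : ℝ) < p := by exact_mod_cast hp.2.pos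
        have h3 : y0 ≤ x / p := by
          refine hxy.trans ?_
          rw [le_div_iff₀ hp0]
          calc Real.sqrt x * p ≤ Real.sqrt x * Real.sqrt x := by gcongr
            _ = x := Real.mul_self_sqrt hx0.le
        have h4 := Li_term hA hx1 hp.2 h2 (hy0 _ h3)
        have h5 : c p * Li (x / (p : ℝ)) - x / Real.log x * (c p / (p : ℝ)) =
            c p * (Li (x / p) - x / Real.log x / p) := by ring
        rw [h5, abs_mul]
        exact (mul_le_of_le_one_left (abs_nonneg _) (hc p)).trans h4
    _ = (8 * A + 2) * (x / Real.log x ^ 2) *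
        ∑ p ∈ (Finset.range (Nat.floor (Real.sqrt x) + 1)).filter Nat.Prime, Real.log p / p := by
        rw [Finset.mul_sum]
    _ ≤ (8 * A + 2) * (x / Real.log x ^ 2) * (3 / (Real.log x)⁻¹) := by gcongr
    _ = _ := by field_simp

end PartI

/-- there are constants `C, c > 0` such that, uniformly for large `x` and
every real primitive `χ` of conductor `d ≤ exp(C (log x)^{1/2})` whose L-function has no real
zero `β > 1 - c/log x`, `Σ_{a ≤ √x} χ(a) Li(x/a) = (x/log x)(𝓛_χ + O(1))` with an absolute
implied constant. -/
theorem statement_14 :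
    ∃ C > (0:ℝ), ∃ c > (0:ℝ), ∃ K > (0:ℝ), ∀ᶠ x : ℝ in atTop,
      ∀ (d : ℕ) (χ : DirichletCharacter ℂ d),
        χ.IsPrimitive → MulChar.IsQuadratic χ → χ ≠ 1 →
        (d : ℝ) ≤ Real.exp (C * Real.sqrt (Real.log x)) →
        (¬ ∃ β : ℝ, 1 - c / Real.log x < β ∧ LFun d χ (β : ℂ) = 0) →
        ∃ L : ℝ, HasCurlyL χ L ∧
          norm ((∑ a ∈ (Finset.range (Nat.floor (Real.sqrt x) + 1)).filter Nat.Prime,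
              χ a * (Li (x / (a : ℝ)) : ℂ)) - (x / Real.log x) * L) ≤
            K * x / Real.log x := by
  obtain ⟨A, hA, hLi⟩ := sum_Li_bound
  set K1 : ℝ := ∑' n : ℕ, ((n : ℝ) ^ 2)⁻¹ + 3 with hK1
  have hK1pos : 0 < K1 := by
    have : 0 ≤ ∑' n : ℕ, ((n : ℝ) ^ 2)⁻¹ := tsum_nonneg fun n => by positivity
    linarith
  refine ⟨1, one_pos, 1 / 5, by norm_num, A + (2 * K1 + 44), by positivity, ?_⟩
  filter_upwards [hLi, prime_sum_compare_x, size_cond, delta_tendsto.eventually vm_bound,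
    delta_tendsto.eventually zeta_bound, eventually_gt_atTop 1,
    Real.tendsto_log_atTop.eventually_ge_atTop 8] with x hLi hU hsize hvm hz hx1 hl8
  intro d χ _ hq hχ hd hzero
  rcases eq_or_ne d 0 with rfl | hd0
  · exact absurd ⟨1, by
      have : 0 < 1 / 5 / Real.log x := by positivity
      linarith, by simp [LFun]⟩ hzero
  haveI : NeZero d := ⟨hd0⟩
  obtain ⟨L, hL⟩ := curly_exists hχ
  refine ⟨L, hL, ?_⟩
  have hl : 0 < Real.log x := by linarith
  have hx0 : 0 < x := by linarith
  have hd1 : (0 : ℝ) < d := by exact_mod_cast NeZero.pos d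
  have hcmp := log_L_compare hχ hq (inv_pos.2 hl) (by
      rw [inv_le_comm₀ hl (by norm_num)]; linarith) hvm hz (by
      have h1 : Real.log (8 * d / (Real.log x)⁻¹) =
          Real.log 8 + Real.log d + Real.log (Real.log x) := by
        rw [div_inv_eq_mul, Real.log_mul (by positivity) hl.ne', Real.log_mul (by norm_num) hd1.ne']
      have h2 : Real.log d ≤ Real.sqrt (Real.log x) := by
        rw [Real.log_le_iff_le_exp hd1]; simpa using hd
      rw [h1, div_inv_eq_mul]
      linarith) (by
      rintro ⟨β, hβ, h0⟩
      refine hzero ⟨β, by rwa [div_eq_mul_inv], ?_⟩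
      rw [LFun, dif_pos hd0]
      exact h0)
  have hU' := hU d χ
  have hN := curly_near hχ hL
  rw [← hK1] at hN hU'
  set S := ∑ p ∈ (Finset.range (Nat.floor (Real.sqrt x) + 1)).filter Nat.Prime, (χ p).re / (p : ℝ)
    with hS
  have hSL : |S - L| ≤ 2 * K1 + 44 := by
    rw [abs_le] at *
    constructor <;> linarith [hU'.1, hU'.2, hN.1, hN.2, hcmp.1, hcmp.2]
  have hLi' := hLi (fun n => (χ n).re) (fun n => (Complex.abs_re_le_norm _).trans (χ.norm_le_one _))
  rw [← hS] at hLi'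
  have hcast : (∑ a ∈ (Finset.range (Nat.floor (Real.sqrt x) + 1)).filter Nat.Prime,
      χ a * (Li (x / (a : ℝ)) : ℂ)) =
      ((∑ p ∈ (Finset.range (Nat.floor (Real.sqrt x) + 1)).filter Nat.Prime,
        (χ p).re * Li (x / (p : ℝ)) : ℝ) : ℂ) := by
    rw [Complex.ofReal_sum]
    refine Finset.sum_congr rfl fun p _ => ?_
    have hre : χ (p : ZMod d) = (((χ (p : ZMod d)).re : ℝ) : ℂ) := by
      rcases hq (p : ZMod d) with h | h | h <;> rw [h] <;> simp
    rw [Complex.ofReal_mul, ← hre]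
  rw [hcast, ← Complex.ofReal_div, ← Complex.ofReal_mul, ← Complex.ofReal_sub, Complex.norm_real,
    Real.norm_eq_abs]
  have hxl : 0 < x / Real.log x := by positivity
  have hfin : |x / Real.log x * S - x / Real.log x * L| ≤ (2 * K1 + 44) * (x / Real.log x) := by
    rw [← mul_sub, abs_mul, abs_of_pos hxl, mul_comm]
    gcongr
  refine (abs_sub_le _ (x / Real.log x * S) _).trans ?_
  rw [mul_div_assoc, add_mul]
  exact add_le_add hLi' hfin
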